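/- arXiv:2006.06811 — 2 statements merged into one kernel-verified Lean document; each statement's English description precedes it below -/
import Mathlib

section
/- Assume X is a polyhedron and the functions {x ↦ exp(αᵀx)}_{α∈𝒜} are linearly independent on X. If Λ is a proper subset of the reduced normalized X-circuits Λ*_X(𝒜), then there exists ỹ ∈ ℝ^𝒜 such that φ_{λ'}(ỹ) ≥ 0 for all λ' ∈ Λ, yet φ_λ(ỹ) < 0 for some λ ∈ Λ*_X(𝒜) ∖ Λ. -/
open Finset

/-- Dot product on `Fin n → ℝ`. -/
noncomputable def dotp {n : ℕ} (y x : Fin n → ℝ) : ℝ := ∑ i, y i * x i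

/-- Support function `σ_X : ℝⁿ → ℝ ∪ {±∞}` of a set `X ⊆ ℝⁿ`. -/
noncomputable def suppFn {n : ℕ} (X : Set (Fin n → ℝ)) (y : Fin n → ℝ) : EReal :=
  ⨆ x ∈ X, ((dotp y x : ℝ) : EReal)

/-- The linear map `𝒜 : ℝ^𝒜 → ℝⁿ`, `ν ↦ Σ_α ν_α α`. -/
noncomputable def Amap {n m : ℕ} (A : Fin m → Fin n → ℝ) (ν : Fin m → ℝ) : Fin n → ℝ :=
  fun j => ∑ i, ν i * A i j

/-- `N_β = {ν : ν_α ≥ 0 (α ≠ β), Σ ν_α = 0}`. -/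
def Nbeta {m : ℕ} (b : Fin m) : Set (Fin m → ℝ) :=
  {ν | (∀ i, i ≠ b → 0 ≤ ν i) ∧ ∑ i, ν i = 0}

/-- Two vectors are proportional if one is a scalar multiple of the other. -/
def Proportional {m : ℕ} (u v : Fin m → ℝ) : Prop :=
  ∃ t : ℝ, u = t • v ∨ v = t • u

/-- The augmented support function `ν ↦ σ_X(-𝒜ν)`. -/
noncomputable def sigA {n m : ℕ} (X : Set (Fin n → ℝ)) (A : Fin m → Fin n → ℝ)
    (ν : Fin m → ℝ) : EReal :=
  suppFn X (-(Amap A ν))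

/-- The map `ν ↦ σ_X(-𝒜ν)` is affine on the segment `[ν1, ν2]`. -/
def SigmaAffineOnSeg {n m : ℕ} (X : Set (Fin n → ℝ)) (A : Fin m → Fin n → ℝ)
    (ν1 ν2 : Fin m → ℝ) : Prop :=
  ∀ t : ℝ, t ∈ Set.Icc (0:ℝ) 1 →
    sigA X A (t • ν1 + (1 - t) • ν2) =
      (t : EReal) * sigA X A ν1 + ((1 - t : ℝ) : EReal) * sigA X A ν2

/-- `ν` is an `X`-circuit of `𝒜` (with negative index allowed only at `b`). -/
def IsXCircuit {n m : ℕ} (X : Set (Fin n → ℝ)) (A : Fin m → Fin n → ℝ)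
    (b : Fin m) (ν : Fin m → ℝ) : Prop :=
  ν ∈ Nbeta b ∧ ν ≠ 0 ∧ sigA X A ν < ⊤ ∧
  ¬ ∃ (ν1 ν2 : Fin m → ℝ) (θ : ℝ), ν1 ∈ Nbeta b ∧ ν2 ∈ Nbeta b ∧
      ¬ Proportional ν1 ν2 ∧ θ ∈ Set.Ioo (0:ℝ) 1 ∧
      ν = θ • ν1 + (1 - θ) • ν2 ∧ SigmaAffineOnSeg X A ν1 ν2

/-- All finite nonnegative combinations of elements of `S` (including `0`). -/
def coneHull {E : Type*} [AddCommMonoid E] [SMul ℝ E] (S : Set E) : Set E :=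
  {x | ∃ (k : ℕ) (t : Fin k → ℝ) (v : Fin k → E),
    (∀ j, 0 ≤ t j) ∧ (∀ j, v j ∈ S) ∧ x = ∑ j, t j • v j}

/-- `v` is an edge generator of the convex cone `K`. -/
def IsEdgeGenerator {E : Type*} [AddCommMonoid E] [SMul ℝ E] (K : Set E) (v : E) : Prop :=
  v ≠ 0 ∧ v ∈ K ∧ ∀ u ∈ K, ∀ w ∈ K, v = u + w →
    (∃ a : ℝ, 0 ≤ a ∧ u = a • v) ∧ (∃ b : ℝ, 0 ≤ b ∧ w = b • v)

/-- The `X`-AGE cone `C_X(𝒜, β)`, as a cone of coefficient vectors. -/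
def AgeCone {n m : ℕ} (X : Set (Fin n → ℝ)) (A : Fin m → Fin n → ℝ) (b : Fin m) :
    Set (Fin m → ℝ) :=
  {c | (∀ i, i ≠ b → 0 ≤ c i) ∧ ∀ x ∈ X, 0 ≤ ∑ i, c i * Real.exp (dotp (A i) x)}

/-- The `X`-SAGE cone `C_X(𝒜) = Σ_β C_X(𝒜, β)`. -/
def Sage {n m : ℕ} (X : Set (Fin n → ℝ)) (A : Fin m → Fin n → ℝ) : Set (Fin m → ℝ) :=
  {c | ∃ f : Fin m → (Fin m → ℝ), (∀ b, f b ∈ AgeCone X A b) ∧ c = ∑ b, f b}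

/-- One summand of the relative entropy, with the conventions `0·log 0 = 0` and
`D = ∞` if `a > 0` while `c ≤ 0`. -/
noncomputable def relEnt (a c : ℝ) : EReal :=
  if a = 0 then 0 else if 0 < c then ((a * Real.log (a / c) : ℝ) : EReal) else ⊤

/-- The relative entropy `D(ν_{∖β}, e · c_{∖β})`. -/
noncomputable def relEntSum {m : ℕ} (b : Fin m) (ν c : Fin m → ℝ) : EReal :=
  ∑ i ∈ Finset.univ.erase b, relEnt (ν i) (Real.exp 1 * c i)

/-- Condition (★): `ν ∈ N_β`, `ν ≠ 0`, `σ_X(-𝒜ν) + D(ν_{∖β}, e c_{∖β}) ≤ c_β`. -/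
def StarCond {n m : ℕ} (X : Set (Fin n → ℝ)) (A : Fin m → Fin n → ℝ)
    (b : Fin m) (c ν : Fin m → ℝ) : Prop :=
  ν ∈ Nbeta b ∧ ν ≠ 0 ∧ sigA X A ν + relEntSum b ν c ≤ (c b : EReal)

/-- The `λ`-witnessed AGE cone `C_X(𝒜, λ)` for a normalized `λ` with `λ_β = -1`. -/
noncomputable def WitnessCone {n m : ℕ} (X : Set (Fin n → ℝ)) (A : Fin m → Fin n → ℝ)
    (b : Fin m) (l : Fin m → ℝ) : Set (Fin m → ℝ) :=
  {c | (∀ i, i ≠ b → 0 ≤ c i) ∧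
    (-(c b)) * Real.exp ((sigA X A l).toReal) ≤
      ∏ i ∈ Finset.univ.filter (fun i => 0 < l i), (c i / l i) ^ (l i)}

/-- Normalized `X`-circuits in `N_β`. -/
def LambdaB {n m : ℕ} (X : Set (Fin n → ℝ)) (A : Fin m → Fin n → ℝ) (b : Fin m) :
    Set (Fin m → ℝ) :=
  {l | IsXCircuit X A b l ∧ l b = -1}

/-- All normalized `X`-circuits of `𝒜`. -/
def Lambda {n m : ℕ} (X : Set (Fin n → ℝ)) (A : Fin m → Fin n → ℝ) : Set (Fin m → ℝ) :=
  ⋃ b, LambdaB X A b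

/-- Functional form `φ_λ = (λ, σ_X(-𝒜λ)) ∈ ℝ^𝒜 × ℝ`. -/
noncomputable def phiVec {n m : ℕ} (X : Set (Fin n → ℝ)) (A : Fin m → Fin n → ℝ)
    (l : Fin m → ℝ) : (Fin m → ℝ) × ℝ :=
  (l, (sigA X A l).toReal)

/-- Functional form as an affine function `φ_λ(y) = Σ y_α λ_α + σ_X(-𝒜λ)`. -/
noncomputable def phiFun {n m : ℕ} (X : Set (Fin n → ℝ)) (A : Fin m → Fin n → ℝ)
    (l : Fin m → ℝ) (y : Fin m → ℝ) : ℝ :=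
  (∑ i, y i * l i) + (sigA X A l).toReal

/-- The circuit graph `G_X(𝒜)`. -/
noncomputable def circuitGraph {n m : ℕ} (X : Set (Fin n → ℝ)) (A : Fin m → Fin n → ℝ) :
    Set ((Fin m → ℝ) × ℝ) :=
  coneHull ((phiVec X A '' Lambda X A) ∪ {((0 : Fin m → ℝ), (1 : ℝ))})

/-- The reduced normalized `X`-circuits `Λ*_X(𝒜)`. -/
noncomputable def LambdaStar {n m : ℕ} (X : Set (Fin n → ℝ)) (A : Fin m → Fin n → ℝ) :
    Set (Fin m → ℝ) :=
  {l | l ∈ Lambda X A ∧ IsEdgeGenerator (circuitGraph X A) (phiVec X A l)}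

/-- `λ`-witnessed AGE cone for a normalized circuit, with `β` recovered from `λ`. -/
noncomputable def WitnessConeL {n m : ℕ} (X : Set (Fin n → ℝ)) (A : Fin m → Fin n → ℝ)
    (l : Fin m → ℝ) : Set (Fin m → ℝ) :=
  ⋃ b ∈ {b : Fin m | l b = -1}, WitnessCone X A b l

/-- Dual cone of a set of coefficient vectors in `ℝ^𝒜`. -/
def dualConeV {m : ℕ} (K : Set (Fin m → ℝ)) : Set (Fin m → ℝ) :=
  {v | ∀ c ∈ K, 0 ≤ ∑ i, v i * c i}

/-- Dual cone of a subset of `ℝ^𝒜 × ℝ`. -/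
def dualConeP {m : ℕ} (K : Set ((Fin m → ℝ) × ℝ)) : Set ((Fin m → ℝ) × ℝ) :=
  {p | ∀ q ∈ K, 0 ≤ (∑ i, p.1 i * q.1 i) + p.2 * q.2}

/-- The basis functions `x ↦ exp(αᵀx)`, `α ∈ 𝒜`, are linearly independent on `X`. -/
def ExpLinIndep {n m : ℕ} (X : Set (Fin n → ℝ)) (A : Fin m → Fin n → ℝ) : Prop :=
  LinearIndependent ℝ (fun i : Fin m => fun x : X => Real.exp (dotp (A i) (x : Fin n → ℝ)))

/-- `X` is a polyhedron: an intersection of finitely many closed halfspaces. -/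
def IsPolyhedron {n : ℕ} (X : Set (Fin n → ℝ)) : Prop :=
  ∃ (k : ℕ) (a : Fin k → Fin n → ℝ) (bb : Fin k → ℝ),
    X = {x | ∀ i, dotp (a i) x ≤ bb i}

/-- Minkowski sum `Σ_{l ∈ Λ} C(l)` (finite sums, one summand per `l`;
the empty sum gives `{0}`). -/
def MinkSumOver {m : ℕ} (Λ : Set (Fin m → ℝ)) (C : (Fin m → ℝ) → Set (Fin m → ℝ)) :
    Set (Fin m → ℝ) :=
  {c | ∃ (s : Finset (Fin m → ℝ)) (f : (Fin m → ℝ) → (Fin m → ℝ)),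
    (↑s ⊆ Λ) ∧ (∀ l ∈ s, f l ∈ C l) ∧ c = ∑ l ∈ s, f l}

/-- **Farkas' lemma** for finitely many linear functionals on a real vector space. -/
theorem farkas_functionals {V ι : Type*} [AddCommGroup V] [Module ℝ V] (s : Finset ι)
    (a : ι → V →ₗ[ℝ] ℝ) (c : V →ₗ[ℝ] ℝ)
    (h : ∀ x, (∀ i ∈ s, 0 ≤ a i x) → 0 ≤ c x) :
    ∃ μ : ι → ℝ, (∀ i, 0 ≤ μ i) ∧ c = ∑ i ∈ s, μ i • a i := by
  classical
  induction s using Finset.induction_on generalizing a c with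
  | empty =>
    refine ⟨0, fun _ => le_rfl, LinearMap.ext fun x => ?_⟩
    have h1 := h x (by simp)
    have h2 := h (-x) (by simp)
    rw [map_neg] at h2
    simp only [Finset.sum_empty, LinearMap.zero_apply]
    linarith
  | insert k s hk ih =>
    by_cases hs : ∀ x, (∀ i ∈ s, 0 ≤ a i x) → 0 ≤ c x
    · obtain ⟨μ, hμ, hc⟩ := ih a c hs
      refine ⟨fun i => if i = k then 0 else μ i, fun i => ?_, ?_⟩
      · dsimp only
        split_ifs
        exacts [le_rfl, hμ i]
      · rw [Finset.sum_insert hk, hc]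
        simp only [if_true, zero_smul, zero_add]
        refine Finset.sum_congr rfl fun i hi => ?_
        rw [if_neg (ne_of_mem_of_not_mem hi hk)]
    · push Not at hs
      obtain ⟨z, hz, hcz⟩ := hs
      have hkz : a k z < 0 := by
        by_contra! hneg
        refine absurd (h z fun i hi => ?_) (not_le.2 hcz)
        rcases Finset.mem_insert.1 hi with rfl | hi
        exacts [hneg, hz i hi]
      set r : ℝ := -(a k z)⁻¹ with hr
      have hr0 : 0 < r := by rw [hr, Left.neg_pos_iff]; exact inv_lt_zero.2 hkz
      have hrk : r * a k z = -1 := by rw [hr, neg_mul, inv_mul_cancel₀ hkz.ne]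
      obtain ⟨μ, hμ, hc⟩ := ih (fun i => a i + (r * a i z) • a k) (c + (r * c z) • a k) (by
        intro x hx
        have key : ∀ f : V →ₗ[ℝ] ℝ, f (x + (r * a k x) • z) = f x + r * f z * a k x := by
          intro f
          simp only [map_add, map_smul, smul_eq_mul]
          ring
        have hx' := h (x + (r * a k x) • z) (by
          intro i hi
          rw [key]
          rcases Finset.mem_insert.1 hi with rfl | hi
          · rw [hrk]; linarith
          · simpa using hx i hi)
        rw [key] at hx'
        simpa using hx')
      refine ⟨fun i => if i = k then ∑ j ∈ s, μ j * (r * a j z) - r * c z else μ i,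
        fun i => ?_, ?_⟩
      · dsimp only
        split_ifs
        · have h1 : 0 ≤ ∑ j ∈ s, μ j * (r * a j z) :=
            Finset.sum_nonneg fun j hj => mul_nonneg (hμ j) (mul_nonneg hr0.le (hz j hj))
          have h2 : r * c z < 0 := mul_neg_of_pos_of_neg hr0 hcz
          linarith
        · exact hμ i
      · rw [Finset.sum_insert hk]
        have hsum : ∑ i ∈ s, (if i = k then ∑ j ∈ s, μ j * (r * a j z) - r * c z else μ i) • a i
            = ∑ i ∈ s, μ i • a i :=
          Finset.sum_congr rfl fun i hi => by rw [if_neg (ne_of_mem_of_not_mem hi hk)]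
        rw [hsum]
        simp only [if_true]
        have hc' : c = ∑ i ∈ s, μ i • (a i + (r * a i z) • a k) - (r * c z) • a k :=
          eq_sub_of_add_eq hc
        refine hc'.trans (LinearMap.ext fun x => ?_)
        simp only [LinearMap.sub_apply, LinearMap.add_apply, LinearMap.smul_apply,
          LinearMap.sum_apply, smul_eq_mul, mul_add, Finset.sum_add_distrib, sub_mul,
          Finset.sum_mul, mul_assoc]
        ring

/-- The standard pairing of `ℝᵈ × ℝ` with itself, as a family of linear functionals. -/
noncomputable def pairFunctional {d : ℕ} (p : (Fin d → ℝ) × ℝ) :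
    ((Fin d → ℝ) × ℝ) →ₗ[ℝ] ℝ where
  toFun q := dotp q.1 p.1 + q.2 * p.2
  map_add' q q' := by
    simp only [dotp, Prod.fst_add, Prod.snd_add, Pi.add_apply, add_mul, Finset.sum_add_distrib]
    ring
  map_smul' r q := by
    simp only [dotp, Prod.smul_fst, Prod.smul_snd, Pi.smul_apply, smul_eq_mul, mul_assoc,
      ← Finset.mul_sum, RingHom.id_apply]
    ring

theorem pairFunctional_apply {d : ℕ} (p q : (Fin d → ℝ) × ℝ) :
    pairFunctional p q = dotp q.1 p.1 + q.2 * p.2 := rfl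

/-- Farkas' lemma for finitely many vectors of `ℝᵈ × ℝ`. -/
theorem farkas_vectors {d : ℕ} {ι : Type*} (s : Finset ι) (v : ι → (Fin d → ℝ) × ℝ)
    (w : (Fin d → ℝ) × ℝ)
    (h : ∀ (x : Fin d → ℝ) (t : ℝ), (∀ i ∈ s, 0 ≤ dotp x (v i).1 + t * (v i).2) →
      0 ≤ dotp x w.1 + t * w.2) :
    ∃ μ : ι → ℝ, (∀ i, 0 ≤ μ i) ∧ w = ∑ i ∈ s, μ i • v i := by
  obtain ⟨μ, hμ, hw⟩ := farkas_functionals s (fun i => pairFunctional (v i)) (pairFunctional w)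
    (fun x hx => h x.1 x.2 hx)
  refine ⟨μ, hμ, Prod.ext (funext fun j => ?_) ?_⟩
  · have := LinearMap.congr_fun hw (Pi.single j 1, 0)
    simpa [pairFunctional_apply, dotp, LinearMap.sum_apply, Pi.single_apply, Prod.fst_sum,
      Finset.sum_apply] using this
  · have := LinearMap.congr_fun hw (0, 1)
    simpa [pairFunctional_apply, dotp, LinearMap.sum_apply, Prod.snd_sum] using this

theorem suppFn_le_coe_iff {n : ℕ} {X : Set (Fin n → ℝ)} {y : Fin n → ℝ} {c : ℝ} :
    suppFn X y ≤ (c : EReal) ↔ ∀ x ∈ X, dotp y x ≤ c := by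
  simp only [suppFn, iSup₂_le_iff, EReal.coe_le_coe_iff]

theorem coe_toReal_suppFn {n : ℕ} {X : Set (Fin n → ℝ)} (hX : X.Nonempty) {y : Fin n → ℝ}
    (hy : suppFn X y < ⊤) : ((suppFn X y).toReal : EReal) = suppFn X y := by
  obtain ⟨x, hx⟩ := hX
  refine EReal.coe_toReal hy.ne (ne_of_gt (lt_of_lt_of_le (EReal.bot_lt_coe (dotp y x)) ?_))
  exact le_iSup₂ (f := fun x (_ : x ∈ X) => ((dotp y x : ℝ) : EReal)) x hx

theorem dotp_le_toReal_suppFn {n : ℕ} {X : Set (Fin n → ℝ)} {y x : Fin n → ℝ} (hx : x ∈ X)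
    (hy : suppFn X y < ⊤) : dotp y x ≤ (suppFn X y).toReal := by
  refine suppFn_le_coe_iff.1 ?_ x hx
  rw [coe_toReal_suppFn ⟨x, hx⟩ hy]

theorem dotp_comm {n : ℕ} (x y : Fin n → ℝ) : dotp x y = dotp y x := by
  simp only [dotp, mul_comm]

theorem dotp_add {n : ℕ} (x y z : Fin n → ℝ) : dotp x (y + z) = dotp x y + dotp x z := by
  simp only [dotp, Pi.add_apply, mul_add, Finset.sum_add_distrib]

theorem dotp_smul {n : ℕ} (x : Fin n → ℝ) (t : ℝ) (y : Fin n → ℝ) :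
    dotp x (t • y) = t * dotp x y := by
  simp only [dotp, Pi.smul_apply, smul_eq_mul, Finset.mul_sum, mul_left_comm]

theorem sum_smul_dotp {n k : ℕ} (a : Fin k → Fin n → ℝ) (μ : Fin k → ℝ) (x : Fin n → ℝ) :
    dotp (∑ i, μ i • a i) x = ∑ i, μ i * dotp (a i) x := by
  simp only [dotp, Finset.sum_apply, Pi.smul_apply, smul_eq_mul, Finset.sum_mul, Finset.mul_sum,
    mul_assoc]
  exact Finset.sum_comm

/-- The polyhedron `{x | aᵢᵀx ≤ bᵢ}`. -/
def halfspaceInter {n k : ℕ} (a : Fin k → Fin n → ℝ) (b : Fin k → ℝ) : Set (Fin n → ℝ) :=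
  {x | ∀ i, dotp (a i) x ≤ b i}

/-- Linear programming duality: a finite support function value of a nonempty polyhedron is
attained by nonnegative multipliers. -/
theorem exists_multipliers {n k : ℕ} (a : Fin k → Fin n → ℝ) (b : Fin k → ℝ)
    (hne : (halfspaceInter a b).Nonempty) {y : Fin n → ℝ}
    (hy : suppFn (halfspaceInter a b) y < ⊤) :
    ∃ μ : Fin k → ℝ, (∀ i, 0 ≤ μ i) ∧ y = ∑ i, μ i • a i ∧
      suppFn (halfspaceInter a b) y = ((∑ i, μ i * b i : ℝ) : EReal) := by
  have hle : ∀ x ∈ halfspaceInter a b, dotp y x ≤ (suppFn (halfspaceInter a b) y).toReal :=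
    fun x hx => dotp_le_toReal_suppFn hx hy
  have hcoe := coe_toReal_suppFn hne hy
  set s := (suppFn (halfspaceInter a b) y).toReal
  obtain ⟨μ, hμ, hw⟩ := farkas_vectors (Finset.univ : Finset (Option (Fin k)))
    (fun o => o.elim ((0 : Fin n → ℝ), (1 : ℝ)) fun i => (a i, b i)) (y, s) (by
      intro x t h
      have ht : 0 ≤ t := by simpa [dotp] using h none (Finset.mem_univ _)
      have hi : ∀ i, 0 ≤ dotp x (a i) + t * b i := fun i => h (some i) (Finset.mem_univ _)
      simp only [dotp_comm x] at hi ⊢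
      rcases ht.eq_or_lt with rfl | ht
      · obtain ⟨x₀, hx₀⟩ := hne
        by_contra! hneg
        simp only [zero_mul, add_zero] at hi hneg
        have hray : ∀ r : ℝ, 0 ≤ r → dotp y x₀ + r * -dotp y x ≤ s := by
          intro r hr
          have := hle (x₀ + (-r) • x) fun i => by
            rw [dotp_add, dotp_smul]
            have := hx₀ i
            have := mul_nonneg hr (hi i)
            linarith
          rw [dotp_add, dotp_smul] at this
          linarith
        have h0 := hray 0 le_rfl
        have h1 := hray ((s - dotp y x₀ + 1) / -dotp y x) (by
          apply div_nonneg <;> linarith)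
        rw [div_mul_cancel₀ _ (by linarith)] at h1
        linarith
      · have := hle ((-t⁻¹) • x) fun i => by
          rw [dotp_smul]
          have h1 : 0 ≤ t⁻¹ * (dotp (a i) x + t * b i) := mul_nonneg (inv_nonneg.2 ht.le) (hi i)
          rw [mul_add, inv_mul_cancel_left₀ ht.ne'] at h1
          linarith
        rw [dotp_smul] at this
        have h2 := mul_le_mul_of_nonneg_left this ht.le
        rw [← mul_assoc, mul_neg, mul_inv_cancel₀ ht.ne'] at h2
        linarith)
  rw [Fintype.sum_option] at hw
  have hw1 : y = ∑ i, μ (some i) • a i := by simpa [Prod.fst_sum] using congrArg Prod.fst hw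
  have hw2 : s = μ none + ∑ i, μ (some i) * b i := by
    simpa [Prod.snd_sum] using congrArg Prod.snd hw
  refine ⟨fun i => μ (some i), fun i => hμ _, hw1, le_antisymm ?_ ?_⟩
  · refine suppFn_le_coe_iff.2 fun x hx => ?_
    rw [hw1, sum_smul_dotp]
    exact Finset.sum_le_sum fun i _ => mul_le_mul_of_nonneg_left (hx i) (hμ _)
  · rw [← hcoe, EReal.coe_le_coe_iff]
    linarith [hμ none]

/-- Multipliers dominated by optimal multipliers are optimal. -/
theorem suppFn_eq_of_dominated {n k : ℕ} {a : Fin k → Fin n → ℝ} {b : Fin k → ℝ}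
    {μ ρ : Fin k → ℝ} {C : ℝ} (hC : 0 < C)
    (hμ : suppFn (halfspaceInter a b) (∑ i, μ i • a i) = ((∑ i, μ i * b i : ℝ) : EReal))
    (hρ : ∀ i, 0 ≤ ρ i) (hρμ : ∀ i, ρ i ≤ C * μ i) :
    suppFn (halfspaceInter a b) (∑ i, ρ i • a i) = ((∑ i, ρ i * b i : ℝ) : EReal) := by
  refine le_antisymm (suppFn_le_coe_iff.2 fun x hx => ?_) ?_
  · rw [sum_smul_dotp]
    exact Finset.sum_le_sum fun i _ => mul_le_mul_of_nonneg_left (hx i) (hρ _)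
  · refine EReal.le_of_forall_lt_iff_le.1 fun c hc => ?_
    have hc' := suppFn_le_coe_iff.1 hc.le
    rw [EReal.coe_le_coe_iff]
    have hgap : ∀ x ∈ halfspaceInter a b,
        ∑ i, ρ i * b i - c ≤ C * (∑ i, μ i * b i - dotp (∑ i, μ i • a i) x) := by
      intro x hx
      have h1 := hc' x hx
      rw [sum_smul_dotp] at h1 ⊢
      rw [← Finset.sum_sub_distrib, Finset.mul_sum]
      calc ∑ i, ρ i * b i - c ≤ ∑ i, ρ i * b i - ∑ i, ρ i * dotp (a i) x := by linarith
        _ = ∑ i, ρ i * (b i - dotp (a i) x) := by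
          rw [← Finset.sum_sub_distrib]; simp only [mul_sub]
        _ ≤ ∑ i, C * (μ i * b i - μ i * dotp (a i) x) := Finset.sum_le_sum fun i _ => by
          have := mul_le_mul_of_nonneg_right (hρμ i) (sub_nonneg.2 (hx i))
          linarith
    have hup : suppFn (halfspaceInter a b) (∑ i, μ i • a i) ≤
        ((∑ i, μ i * b i - C⁻¹ * (∑ i, ρ i * b i - c) : ℝ) : EReal) := by
      refine suppFn_le_coe_iff.2 fun x hx => ?_
      have := mul_le_mul_of_nonneg_left (hgap x hx) (inv_nonneg.2 hC.le)
      rw [inv_mul_cancel_left₀ hC.ne'] at this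
      linarith
    rw [hμ, EReal.coe_le_coe_iff] at hup
    have : 0 < C⁻¹ := inv_pos.2 hC
    by_contra! hlt
    have := mul_pos this (sub_pos.2 hlt)
    linarith

theorem exists_pos_forall_mul_le {ι : Type*} [Finite ι] (f g : ι → ℝ) (hf : ∀ i, 0 ≤ f i)
    (hfg : ∀ i, f i = 0 → g i = 0) : ∃ ε > 0, ∀ δ, 0 ≤ δ → δ ≤ ε → ∀ i, δ * g i ≤ f i := by
  have hev : ∀ i, ∀ᶠ δ in nhdsWithin (0 : ℝ) (Set.Ici 0), δ * g i ≤ f i := by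
    intro i
    rcases (hf i).eq_or_lt with h0 | hpos
    · simp [← h0, hfg i h0.symm]
    · have : Filter.Tendsto (fun δ : ℝ => δ * g i) (nhdsWithin 0 (Set.Ici 0)) (nhds 0) := by
        have hc : Continuous fun δ : ℝ => δ * g i := by fun_prop
        simpa using (hc.tendsto 0).mono_left nhdsWithin_le_nhds
      exact this.eventually_le_const hpos
  obtain ⟨ε, hε, h⟩ := mem_nhdsGE_iff_exists_Icc_subset.1 (Filter.eventually_all.2 hev)
  exact ⟨ε, hε, fun δ h0 h1 => h ⟨h0, h1⟩⟩

theorem neg_Amap_comb {n m : ℕ} (A : Fin m → Fin n → ℝ) (s t : ℝ) (u v : Fin m → ℝ) :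
    -Amap A (s • u + t • v) = s • (-Amap A u) + t • (-Amap A v) := by
  ext j
  simp only [Amap, Pi.neg_apply, Pi.add_apply, Pi.smul_apply, smul_eq_mul, add_mul,
    Finset.sum_add_distrib, mul_assoc, ← Finset.mul_sum]
  ring

theorem sum_comb_smul {n k : ℕ} (a : Fin k → Fin n → ℝ) (s t : ℝ) (μ ρ : Fin k → ℝ) :
    ∑ i, (s * μ i + t * ρ i) • a i = s • ∑ i, μ i • a i + t • ∑ i, ρ i • a i := by
  simp only [add_smul, Finset.sum_add_distrib, mul_smul, Finset.smul_sum]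

theorem sum_comb_mul {k : ℕ} (b : Fin k → ℝ) (s t : ℝ) (μ ρ : Fin k → ℝ) :
    ∑ i, (s * μ i + t * ρ i) * b i = s * ∑ i, μ i * b i + t * ∑ i, ρ i * b i := by
  simp only [add_mul, Finset.sum_add_distrib, mul_assoc, Finset.mul_sum]

/-- A normalized circuit of a polyhedron is determined by its negative index, its zero set and the
zero set of a vector of optimal dual multipliers. -/
theorem circuit_unique {n m k : ℕ} {a : Fin k → Fin n → ℝ} {b : Fin k → ℝ}
    {A : Fin m → Fin n → ℝ} {β : Fin m} {ν ν' : Fin m → ℝ} {μ μ' : Fin k → ℝ}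
    (hν : ν ∈ LambdaB (halfspaceInter a b) A β) (hν' : ν' ∈ LambdaB (halfspaceInter a b) A β)
    (hμ : ∀ i, 0 ≤ μ i) (hμ' : ∀ i, 0 ≤ μ' i)
    (hy : -Amap A ν = ∑ i, μ i • a i) (hy' : -Amap A ν' = ∑ i, μ' i • a i)
    (hopt : suppFn (halfspaceInter a b) (-Amap A ν) = ((∑ i, μ i * b i : ℝ) : EReal))
    (hzero : ∀ i, ν i = 0 → ν' i = 0) (hzeroμ : ∀ i, μ i = 0 → μ' i = 0) : ν = ν' := by
  by_contra hne
  obtain ⟨⟨⟨hνpos, hνsum⟩, -, -, hext⟩, hνβ⟩ := hν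
  obtain ⟨⟨⟨hνpos', hνsum'⟩, -, -, -⟩, hνβ'⟩ := hν'
  obtain ⟨ε₁, hε₁, h₁⟩ := exists_pos_forall_mul_le μ μ' hμ hzeroμ
  obtain ⟨ε₂, hε₂, h₂⟩ := exists_pos_forall_mul_le (fun i : {i // i ≠ β} => ν i)
    (fun i => ν' i) (fun i => hνpos i i.2) (fun i => hzero i)
  obtain ⟨ε, hε, hle₁, hle₂⟩ : ∃ ε > 0, ε ≤ ε₁ ∧ ε ≤ ε₂ :=
    ⟨min ε₁ ε₂, lt_min hε₁ hε₂, min_le_left _ _, min_le_right _ _⟩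
  have hεμ := h₁ ε hε.le hle₁
  have hεν : ∀ i, i ≠ β → ε * ν' i ≤ ν i := fun i hi => h₂ ε hε.le hle₂ ⟨i, hi⟩
  have hμ'le : ∀ i, μ' i ≤ ε⁻¹ * μ i := fun i => by
    rw [le_inv_mul_iff₀ hε]; exact hεμ i
  rw [hy] at hopt
  have hC : 0 < ε⁻¹ + (1 + ε) := by positivity
  set ν'' : Fin m → ℝ := (1 + ε) • ν + (-ε) • ν' with hν''
  set μ'' : Fin k → ℝ := fun i => (1 + ε) * μ i + (-ε) * μ' i with hμ''
  have hμ''0 : ∀ i, 0 ≤ μ'' i := fun i => by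
    have := hεμ i
    have := mul_nonneg hε.le (hμ i)
    have := hμ i
    simp only [hμ'']
    linarith
  have hμ''le : ∀ i, μ'' i ≤ (1 + ε) * μ i := fun i => by
    have := mul_nonneg hε.le (hμ' i)
    simp only [hμ'']
    linarith
  have hy'' : -Amap A ν'' = ∑ i, μ'' i • a i := by
    rw [hν'', neg_Amap_comb, hy, hy', hμ'', sum_comb_smul]
  have hseg : ∀ s t : ℝ, 0 ≤ s → 0 ≤ t → s ≤ 1 → t ≤ 1 →
      sigA (halfspaceInter a b) A (s • ν' + t • ν'') =
        ((s * ∑ i, μ' i * b i + t * ∑ i, μ'' i * b i : ℝ) : EReal) := by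
    intro s t hs ht hs1 ht1
    rw [sigA, neg_Amap_comb, hy', hy'', ← sum_comb_smul, ← sum_comb_mul]
    refine suppFn_eq_of_dominated hC hopt (fun i => ?_) fun i => ?_
    · exact add_nonneg (mul_nonneg hs (hμ' i)) (mul_nonneg ht (hμ''0 i))
    · have h1 := mul_le_mul_of_nonneg_right hs1 (hμ' i)
      have h2 := mul_le_mul_of_nonneg_right ht1 (hμ''0 i)
      have h3 := hμ'le i
      have h4 := hμ''le i
      linarith
  have hβ'' : ν'' β = -1 := by
    simp only [hν'', Pi.add_apply, Pi.smul_apply, smul_eq_mul, hνβ, hνβ']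
    ring
  refine hext ⟨ν', ν'', ε / (1 + ε), ⟨hνpos', hνsum'⟩, ⟨fun i hi => ?_, ?_⟩, ?_, ⟨?_, ?_⟩, ?_, ?_⟩
  · have := hεν i hi
    have := mul_nonneg hε.le (hνpos i hi)
    have := hνpos i hi
    simp only [hν'', Pi.add_apply, Pi.smul_apply, smul_eq_mul]
    linarith
  · simp only [hν'', Pi.add_apply, Pi.smul_apply, smul_eq_mul, Finset.sum_add_distrib,
      ← Finset.mul_sum, hνsum, hνsum', mul_zero, add_zero]
  · rintro ⟨t, ht⟩
    have heq : ν' = ν'' := by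
      rcases ht with ht | ht
      · have h1 := congrFun ht β
        rw [Pi.smul_apply, smul_eq_mul, hνβ', hβ''] at h1
        rw [ht, show t = 1 by linarith, one_smul]
      · have h1 := congrFun ht β
        rw [Pi.smul_apply, smul_eq_mul, hνβ', hβ''] at h1
        rw [ht, show t = 1 by linarith, one_smul]
    refine hne (funext fun i => ?_)
    have h1 := congrFun heq i
    simp only [hν'', Pi.add_apply, Pi.smul_apply, smul_eq_mul] at h1
    have h2 : (1 + ε) * (ν i - ν' i) = 0 := by linarith
    rcases mul_eq_zero.1 h2 with h2 | h2 <;> linarith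
  · positivity
  · rw [div_lt_one (by linarith)]
    linarith
  · ext i
    simp only [hν'', Pi.add_apply, Pi.smul_apply, smul_eq_mul]
    field_simp
    ring
  · rintro t ⟨ht0, ht1⟩
    have h1 := hseg 1 0 zero_le_one le_rfl le_rfl zero_le_one
    have h2 := hseg 0 1 le_rfl zero_le_one zero_le_one le_rfl
    simp only [one_smul, zero_smul, add_zero, zero_add, one_mul, zero_mul] at h1 h2
    rw [hseg t (1 - t) ht0 (by linarith) ht1 (by linarith), h1, h2]
    norm_cast

/-- A nonempty polyhedron has only finitely many normalized circuits. -/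
theorem finite_Lambda {n m : ℕ} {X : Set (Fin n → ℝ)} (hX : X.Nonempty) (hpoly : IsPolyhedron X)
    (A : Fin m → Fin n → ℝ) : (Lambda X A).Finite := by
  obtain ⟨k, a, b, rfl⟩ := hpoly
  change (Lambda (halfspaceInter a b) A).Finite
  have hdata : ∀ l : Lambda (halfspaceInter a b) A, ∃ (β : Fin m) (μ : Fin k → ℝ),
      (l : Fin m → ℝ) ∈ LambdaB (halfspaceInter a b) A β ∧ (∀ i, 0 ≤ μ i) ∧
      -Amap A l = ∑ i, μ i • a i ∧
      suppFn (halfspaceInter a b) (-Amap A l) = ((∑ i, μ i * b i : ℝ) : EReal) := by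
    rintro ⟨l, hl⟩
    obtain ⟨β, hβ⟩ := Set.mem_iUnion.1 hl
    obtain ⟨μ, hμ⟩ := exists_multipliers a b hX hβ.1.2.2.1
    exact ⟨β, μ, hβ, hμ⟩
  choose β μ hl hμ hy hopt using hdata
  have hinj : Function.Injective fun l : Lambda (halfspaceInter a b) A =>
      (β l, {i | (l : Fin m → ℝ) i = 0}, {i | μ l i = 0}) := by
    intro l l' h
    simp only [Prod.mk.injEq, Set.ext_iff, Set.mem_ofPred_eq] at h
    obtain ⟨h1, h2, h3⟩ := h
    refine Subtype.ext (circuit_unique (hl l) (h1 ▸ hl l') (hμ l) (hμ l') (hy l) (hy l') (hopt l)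
      (fun i => (h2 i).1) fun i => (h3 i).1)
  exact Set.finite_coe_iff.1 (Finite.of_injective _ hinj)

theorem sum_smul_mem_coneHull {E : Type*} [AddCommMonoid E] [SMul ℝ E] {S : Set E} (s : Finset E)
    (hs : ↑s ⊆ S) (μ : E → ℝ) (hμ : ∀ v, 0 ≤ μ v) : ∑ v ∈ s, μ v • v ∈ coneHull S := by
  refine ⟨s.card, fun j => μ (s.equivFin.symm j), fun j => s.equivFin.symm j, fun j => hμ _,
    fun j => hs (s.equivFin.symm j).2, ?_⟩
  rw [Equiv.sum_comp s.equivFin.symm fun v : s => μ v • (v : E), Finset.sum_coe_sort s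
    fun v => μ v • v]

theorem phiFun_eq_dotp {n m : ℕ} (X : Set (Fin n → ℝ)) (A : Fin m → Fin n → ℝ)
    (l y : Fin m → ℝ) : phiFun X A l y = dotp y l + (sigA X A l).toReal := rfl

/-- The functional form of a normalized circuit is nonnegative at the moment vector of a point of
`X`. -/
theorem phiFun_moment_nonneg {n m : ℕ} {X : Set (Fin n → ℝ)} {A : Fin m → Fin n → ℝ}
    {l : Fin m → ℝ} (hl : l ∈ Lambda X A) {x : Fin n → ℝ} (hx : x ∈ X) :
    0 ≤ phiFun X A l fun i => dotp (A i) x := by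
  obtain ⟨β, hβ⟩ := Set.mem_iUnion.1 hl
  have h := dotp_le_toReal_suppFn hx hβ.1.2.2.1
  have hsum : dotp (-Amap A l) x = -dotp (fun i => dotp (A i) x) l := by
    simp only [dotp, Amap, Pi.neg_apply, neg_mul, Finset.sum_neg_distrib, Finset.sum_mul]
    rw [Finset.sum_comm]
    congr 1
    exact Finset.sum_congr rfl fun i _ => Finset.sum_congr rfl fun j _ => by ring
  rw [hsum] at h
  rw [phiFun_eq_dotp, sigA]
  linarith

/-- Proportional functional forms come from equal normalized circuits. -/
theorem eq_of_smul_eq_smul_of_normalized {n m : ℕ} {X : Set (Fin n → ℝ)} {A : Fin m → Fin n → ℝ}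
    {β : Fin m} {l l' : Fin m → ℝ} (hl : l β = -1) (hl' : l' ∈ Lambda X A) (hneg : l' β < 0)
    {r t : ℝ} (hr : 0 < r) (h : r • l' = t • l) : l' = l := by
  obtain ⟨β', hβ'⟩ := Set.mem_iUnion.1 hl'
  have hββ' : β = β' := by
    by_contra hne
    exact absurd (hβ'.1.1.1 β hne) (not_le.2 hneg)
  subst hββ'
  have h1 := congrFun h β
  simp only [Pi.smul_apply, smul_eq_mul, hl, hβ'.2] at h1
  obtain rfl : r = t := by linarith
  exact smul_right_injective _ hr.ne' h

/-- The functional form of a reduced circuit can be strictly separated, by a vector of nonnegative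
last coordinate, from any set of other circuits. -/
theorem exists_separating {n m : ℕ} {X : Set (Fin n → ℝ)} {A : Fin m → Fin n → ℝ}
    (hfin : (Lambda X A).Finite) {Λ : Set (Fin m → ℝ)} (hΛ : Λ ⊆ Lambda X A) {l : Fin m → ℝ}
    (hl : l ∈ LambdaStar X A) (hlΛ : l ∉ Λ) :
    ∃ (y : Fin m → ℝ) (t : ℝ), 0 ≤ t ∧
      (∀ l' ∈ Λ, 0 ≤ dotp y l' + t * (sigA X A l').toReal) ∧
      dotp y l + t * (sigA X A l).toReal < 0 := by
  classical
  by_contra! hcon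
  set s : Finset ((Fin m → ℝ) × ℝ) :=
    insert (0, 1) ((hfin.subset hΛ).toFinset.image (phiVec X A)) with hs
  have hsS : (s : Set ((Fin m → ℝ) × ℝ)) ⊆ (phiVec X A '' Lambda X A) ∪ {(0, 1)} := by
    intro v hv
    rcases Finset.mem_insert.1 hv with rfl | hv
    · exact Or.inr rfl
    · obtain ⟨l', hl', rfl⟩ := Finset.mem_image.1 hv
      exact Or.inl ⟨l', hΛ ((hfin.subset hΛ).mem_toFinset.1 hl'), rfl⟩
  obtain ⟨μ, hμ, hw⟩ := farkas_vectors s id (phiVec X A l) (by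
    intro y t h
    refine hcon y t ?_ fun l' hl' => ?_
    · simpa [dotp] using h (0, 1) (Finset.mem_insert_self _ _)
    · exact h (phiVec X A l') (Finset.mem_insert_of_mem
        (Finset.mem_image_of_mem _ ((hfin.subset hΛ).mem_toFinset.2 hl'))))
  obtain ⟨hlΛX, -, -, hedge⟩ := hl
  obtain ⟨β, hβ⟩ := Set.mem_iUnion.1 hlΛX
  have hwβ : ∑ v ∈ s, μ v * v.1 β = -1 := by
    have := congrFun (congrArg Prod.fst hw) β
    simp only [phiVec, Prod.fst_sum, Finset.sum_apply, Prod.smul_fst, Pi.smul_apply, id,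
      smul_eq_mul, hβ.2] at this
    exact this.symm
  obtain ⟨v, hv, hvneg⟩ : ∃ v ∈ s, μ v * v.1 β < 0 := by
    by_contra! hnn
    linarith [Finset.sum_nonneg hnn]
  have hμv : 0 < μ v := (hμ v).lt_of_ne fun h0 => by simp [← h0] at hvneg
  have hvβ : v.1 β < 0 := by
    by_contra! h0
    exact absurd (mul_nonneg (hμ v) h0) (not_le.2 hvneg)
  obtain ⟨⟨r, -, hr⟩, -⟩ := hedge (μ v • v)
    (by
      have := sum_smul_mem_coneHull {v} (Finset.singleton_subset_set_iff.2 (hsS hv)) μ hμ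
      rwa [Finset.sum_singleton] at this)
    (∑ u ∈ s.erase v, μ u • u)
    (sum_smul_mem_coneHull _ (fun u hu => hsS (Finset.mem_of_mem_erase hu)) μ hμ)
    (by rw [Finset.add_sum_erase s (fun u => μ u • u) hv]; exact hw)
  rcases Finset.mem_insert.1 hv with rfl | hv
  · simp at hvβ
  · obtain ⟨l', hl', rfl⟩ := Finset.mem_image.1 hv
    have hl' := (hfin.subset hΛ).mem_toFinset.1 hl'
    exact hlΛ (eq_of_smul_eq_smul_of_normalized hβ.2 (hΛ hl') hvβ hμv (congrArg Prod.fst hr) ▸ hl')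

theorem statement16 {n m : ℕ} (X : Set (Fin n → ℝ)) (hXne : X.Nonempty)
    (hpoly : IsPolyhedron X)
    (A : Fin m → Fin n → ℝ) (hA : Function.Injective A) (hm : 0 < m)
    (hLI : ExpLinIndep X A)
    (Λ : Set (Fin m → ℝ)) (hsub : Λ ⊆ LambdaStar X A) (hne : Λ ≠ LambdaStar X A) :
    ∃ y : Fin m → ℝ, (∀ l ∈ Λ, 0 ≤ phiFun X A l y) ∧
      ∃ l ∈ LambdaStar X A \ Λ, phiFun X A l y < 0 := by
  obtain ⟨l, hl, hlΛ⟩ := Set.exists_of_ssubset (hsub.ssubset_of_ne hne)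
  obtain ⟨y, t, ht, hyΛ, hyl⟩ := exists_separating (finite_Lambda hXne hpoly A)
    (fun l' hl' => (hsub hl').1) hl hlΛ
  obtain ⟨x, hx⟩ := hXne
  set z : Fin m → ℝ := fun i => dotp (A i) x
  obtain ⟨r, hr, hrl⟩ : ∃ r > 0, dotp y l + t * (sigA X A l).toReal + r * phiFun X A l z < 0 := by
    have hz := phiFun_moment_nonneg hl.1 hx
    refine ⟨-(dotp y l + t * (sigA X A l).toReal) / (phiFun X A l z + 1), ?_, ?_⟩
    · exact div_pos (by linarith) (by linarith)
    · rw [div_mul_eq_mul_div, ← lt_neg_iff_add_neg', div_lt_iff₀ (by linarith)]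
      linarith
  have htr : 0 < t + r := by linarith
  have hscale : ∀ l', phiFun X A l' ((t + r)⁻¹ • (y + r • z)) =
      (t + r)⁻¹ * (dotp y l' + t * (sigA X A l').toReal + r * phiFun X A l' z) := by
    intro l'
    rw [phiFun_eq_dotp, phiFun_eq_dotp, dotp_comm, dotp_smul, dotp_add, dotp_smul, dotp_comm l',
      dotp_comm l']
    field_simp
    ring
  refine ⟨(t + r)⁻¹ • (y + r • z), fun l' hl' => ?_, l, ⟨hl, hlΛ⟩, ?_⟩
  · rw [hscale]
    exact mul_nonneg (inv_nonneg.2 htr.le) (add_nonneg (hyΛ l' hl')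
      (mul_nonneg hr.le (phiFun_moment_nonneg (hsub hl').1 hx)))
  · rw [hscale]
    exact mul_neg_of_pos_of_neg (inv_pos.2 htr) hrl
end

section
/- Let m ≥ 2, let α₁ < α₂ < … < α_m be real numbers, 𝒜 = {α₁,…,α_m} ⊂ ℝ, and X = [0,∞). Identify coefficient vectors with c ∈ ℝᵐ and let C = C_{[0,∞)}(𝒜) ⊆ ℝᵐ be the X-SAGE cone. Then c ∈ ℝᵐ is an edge generator of C if and only if c is a positive multiple of one of the following: (1) δ₁ (the signomial exp(α₁x)); (2) δ₂ − δ₁ (the signomial exp(α₂x) − exp(α₁x)); (3) for some index i with 2 ≤ i ≤ m−1, a vector c supported on {i−1, i, i+1} with c_{i+1} > 0, c_{i−1} > 0, c_i = −(c_{i−1}/λ_{i−1})^{λ_{i−1}}·(c_{i+1}/λ_{i+1})^{λ_{i+1}}, and c_{i−1}/c_{i+1} ≥ λ_{i−1}/λ_{i+1}, where λ_{i+1} = (α_i − α_{i−1})/(α_{i+1} − α_{i−1}) and λ_{i−1} = (α_{i+1} − α_i)/(α_{i+1} − α_{i−1}). -/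
open Finset

/-- The `[0,∞)`-AGE cone for univariate exponents `α : Fin m → ℝ`. -/
def AgeCone1 {m : ℕ} (α : Fin m → ℝ) (b : Fin m) : Set (Fin m → ℝ) :=
  {c | (∀ j, j ≠ b → 0 ≤ c j) ∧ ∀ x : ℝ, 0 ≤ x → 0 ≤ ∑ j, c j * Real.exp (α j * x)}

/-- The `[0,∞)`-SAGE cone for univariate exponents. -/
def Sage1 {m : ℕ} (α : Fin m → ℝ) : Set (Fin m → ℝ) :=
  {c | ∃ f : Fin m → (Fin m → ℝ), (∀ b, f b ∈ AgeCone1 α b) ∧ c = ∑ b, f b}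

/-- `λ_{i-1} = (α_{i+1} - α_i)/(α_{i+1} - α_{i-1})`. -/
noncomputable def lamMinus {m : ℕ} (α : Fin m → ℝ) (i : ℕ) (h1 : 1 ≤ i)
    (h2 : i + 1 < m) : ℝ :=
  (α ⟨i + 1, h2⟩ - α ⟨i, by omega⟩) / (α ⟨i + 1, h2⟩ - α ⟨i - 1, by omega⟩)

/-- `λ_{i+1} = (α_i - α_{i-1})/(α_{i+1} - α_{i-1})`. -/
noncomputable def lamPlus {m : ℕ} (α : Fin m → ℝ) (i : ℕ) (h1 : 1 ≤ i)
    (h2 : i + 1 < m) : ℝ :=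
  (α ⟨i, by omega⟩ - α ⟨i - 1, by omega⟩) / (α ⟨i + 1, h2⟩ - α ⟨i - 1, by omega⟩)

/-- The signomial `x ↦ Σ_j c_j exp(α_j x)`. -/
noncomputable def expSum {m : ℕ} (α c : Fin m → ℝ) (x : ℝ) : ℝ :=
  ∑ j, c j * Real.exp (α j * x)

/-- The derivative of `expSum α c`. -/
noncomputable def expSumDeriv {m : ℕ} (α c : Fin m → ℝ) (x : ℝ) : ℝ :=
  ∑ j, c j * (α j * Real.exp (α j * x))

/-- The signomial supported on `{p, q, k}` with a double zero at `x`. -/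
noncomputable def circuitVec {m : ℕ} (α : Fin m → ℝ) (x : ℝ) (p q k : Fin m) : Fin m → ℝ :=
  Pi.single p ((α k - α q) * Real.exp (-(α p * x)))
    - Pi.single q ((α k - α p) * Real.exp (-(α q * x)))
    + Pi.single k ((α q - α p) * Real.exp (-(α k * x)))

section Linearity

variable {m : ℕ} (α : Fin m → ℝ)

lemma expSum_add (c d : Fin m → ℝ) (x : ℝ) :
    expSum α (c + d) x = expSum α c x + expSum α d x := by
  simp [expSum, add_mul, Finset.sum_add_distrib]

lemma expSum_sub (c d : Fin m → ℝ) (x : ℝ) :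
    expSum α (c - d) x = expSum α c x - expSum α d x := by
  simp [expSum, sub_mul, Finset.sum_sub_distrib]

lemma expSum_smul (t : ℝ) (c : Fin m → ℝ) (x : ℝ) :
    expSum α (t • c) x = t * expSum α c x := by
  simp [expSum, Finset.mul_sum, mul_assoc]

lemma expSum_sum {ι : Type*} (s : Finset ι) (f : ι → Fin m → ℝ) (x : ℝ) :
    expSum α (∑ i ∈ s, f i) x = ∑ i ∈ s, expSum α (f i) x := by
  simp only [expSum, Finset.sum_apply, Finset.sum_mul]
  exact Finset.sum_comm

lemma expSum_single (p : Fin m) (y x : ℝ) :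
    expSum α (Pi.single p y) x = y * Real.exp (α p * x) := by
  simp [expSum, Pi.single_apply]

lemma expSumDeriv_add (c d : Fin m → ℝ) (x : ℝ) :
    expSumDeriv α (c + d) x = expSumDeriv α c x + expSumDeriv α d x := by
  simp [expSumDeriv, add_mul, Finset.sum_add_distrib]

lemma expSumDeriv_sub (c d : Fin m → ℝ) (x : ℝ) :
    expSumDeriv α (c - d) x = expSumDeriv α c x - expSumDeriv α d x := by
  simp [expSumDeriv, sub_mul, Finset.sum_sub_distrib]

lemma expSumDeriv_smul (t : ℝ) (c : Fin m → ℝ) (x : ℝ) :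
    expSumDeriv α (t • c) x = t * expSumDeriv α c x := by
  simp [expSumDeriv, Finset.mul_sum, mul_assoc]

lemma expSumDeriv_sum {ι : Type*} (s : Finset ι) (f : ι → Fin m → ℝ) (x : ℝ) :
    expSumDeriv α (∑ i ∈ s, f i) x = ∑ i ∈ s, expSumDeriv α (f i) x := by
  simp only [expSumDeriv, Finset.sum_apply, Finset.sum_mul]
  exact Finset.sum_comm

lemma expSumDeriv_single (p : Fin m) (y x : ℝ) :
    expSumDeriv α (Pi.single p y) x = y * (α p * Real.exp (α p * x)) := by
  simp [expSumDeriv, Pi.single_apply]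

lemma expSum_circuitVec (x : ℝ) (p q k : Fin m) : expSum α (circuitVec α x p q k) x = 0 := by
  simp only [circuitVec, expSum_add, expSum_sub, expSum_single, mul_assoc, ← Real.exp_add,
    neg_add_cancel, Real.exp_zero]
  ring

lemma expSumDeriv_circuitVec (x : ℝ) (p q k : Fin m) :
    expSumDeriv α (circuitVec α x p q k) x = 0 := by
  have h : ∀ i, Real.exp (-(α i * x)) * Real.exp (α i * x) = 1 := fun i => by
    rw [← Real.exp_add]; simp
  simp only [circuitVec, expSumDeriv_add, expSumDeriv_sub, expSumDeriv_single]
  linear_combination (α k - α q) * α p * h p - (α k - α p) * α q * h q + (α q - α p) * α k * h k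

lemma hasDerivAt_expSum (c : Fin m → ℝ) (x : ℝ) :
    HasDerivAt (expSum α c) (expSumDeriv α c x) x := by
  unfold expSum expSumDeriv
  refine HasDerivAt.fun_sum fun j _ => HasDerivAt.const_mul _ ?_
  have := ((hasDerivAt_id x).const_mul (α j)).exp
  simpa [mul_comm] using this

end Linearity

section Nonneg

variable {m : ℕ} {α : Fin m → ℝ} {c : Fin m → ℝ}

lemma expSumDeriv_nonneg (hc : ∀ x, 0 ≤ x → 0 ≤ expSum α c x) {x₀ : ℝ} (hx₀ : 0 ≤ x₀)
    (h0 : expSum α c x₀ = 0) : 0 ≤ expSumDeriv α c x₀ := by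
  have h := ((hasDerivAt_expSum α c x₀).hasDerivWithinAt (s := Set.Ioi x₀))
  rw [hasDerivWithinAt_iff_tendsto_slope' (by simp)] at h
  refine ge_of_tendsto h ?_
  filter_upwards [self_mem_nhdsWithin] with y hy
  have hy' : x₀ < y := hy
  rw [slope_def_field, h0, sub_zero]
  exact div_nonneg (hc y (hx₀.trans hy'.le)) (sub_nonneg.2 hy'.le)

lemma expSumDeriv_eq_zero (hc : ∀ x, 0 ≤ x → 0 ≤ expSum α c x) {x₀ : ℝ} (hx₀ : 0 < x₀)
    (h0 : expSum α c x₀ = 0) : expSumDeriv α c x₀ = 0 := by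
  refine IsLocalMin.hasDerivAt_eq_zero ?_ (hasDerivAt_expSum α c x₀)
  filter_upwards [lt_mem_nhds hx₀] with y hy
  rw [h0]
  exact hc y hy.le

lemma coeff_nonneg_of_top (hmono : StrictMono α) (hc : ∀ x, 0 ≤ x → 0 ≤ expSum α c x)
    {p : Fin m} (hp : ∀ j, p < j → c j = 0) : 0 ≤ c p := by
  have key : Filter.Tendsto (fun x => ∑ j, c j * Real.exp ((α j - α p) * x)) Filter.atTop
      (nhds (∑ j, if j = p then c p else 0)) := by
    refine tendsto_finsetSum _ fun j _ => ?_
    rcases lt_trichotomy j p with h | h | h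
    · rw [if_neg h.ne]
      have h1 : Filter.Tendsto (fun x => (α j - α p) * x) Filter.atTop Filter.atBot :=
        Filter.tendsto_id.const_mul_atTop_of_neg (sub_neg.2 (hmono h))
      simpa using (Real.tendsto_exp_atBot.comp h1).const_mul (c j)
    · subst h
      simp
    · simp [hp j h, h.ne']
  rw [Finset.sum_ite_eq' Finset.univ p, if_pos (Finset.mem_univ p)] at key
  refine ge_of_tendsto key ?_
  filter_upwards [Filter.eventually_ge_atTop 0] with x hx
  have : ∑ j, c j * Real.exp ((α j - α p) * x) = expSum α c x * Real.exp (-(α p * x)) := by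
    rw [expSum, Finset.sum_mul]
    refine Finset.sum_congr rfl fun j _ => ?_
    rw [mul_assoc, ← Real.exp_add]
    ring_nf
  rw [this]
  exact mul_nonneg (hc x hx) (Real.exp_pos _).le

lemma eq_zero_of_add_eq_zero_above (hmono : StrictMono α) {u w : Fin m → ℝ}
    (hu : ∀ x, 0 ≤ x → 0 ≤ expSum α u x) (hw : ∀ x, 0 ≤ x → 0 ≤ expSum α w x) {p : Fin m}
    (h : ∀ j, p < j → u j + w j = 0) : ∀ j, p < j → u j = 0 ∧ w j = 0 := by
  intro j
  induction j using WellFoundedGT.induction with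
  | ind j ih =>
    intro hj
    have h1 := coeff_nonneg_of_top hmono hu fun l hl => (ih l hl (hj.trans hl)).1
    have h2 := coeff_nonneg_of_top hmono hw fun l hl => (ih l hl (hj.trans hl)).2
    have h3 := h j hj
    constructor <;> linarith

end Nonneg

section Cones

variable {m : ℕ} {α : Fin m → ℝ} {c : Fin m → ℝ}

lemma expSum_nonneg_of_mem_sage (hc : c ∈ Sage1 α) (x : ℝ) (hx : 0 ≤ x) : 0 ≤ expSum α c x := by
  obtain ⟨f, hf, rfl⟩ := hc
  rw [expSum_sum]
  exact Finset.sum_nonneg fun b _ => (hf b).2 x hx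

lemma smul_mem_age {b : Fin m} (hc : c ∈ AgeCone1 α b) {t : ℝ} (ht : 0 ≤ t) :
    t • c ∈ AgeCone1 α b := by
  refine ⟨fun j hj => mul_nonneg ht (hc.1 j hj), fun x hx => ?_⟩
  have := expSum_smul α t c x
  exact (mul_nonneg ht (hc.2 x hx)).trans_eq this.symm

lemma zero_mem_age (b : Fin m) : (0 : Fin m → ℝ) ∈ AgeCone1 α b := by
  constructor <;> simp

lemma mem_age_of_nonneg (hc : ∀ j, 0 ≤ c j) (b : Fin m) : c ∈ AgeCone1 α b :=
  ⟨fun j _ => hc j, fun _ _ => Finset.sum_nonneg fun j _ => mul_nonneg (hc j) (Real.exp_pos _).le⟩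

lemma mem_sage_of_mem_age {b : Fin m} (hc : c ∈ AgeCone1 α b) : c ∈ Sage1 α := by
  refine ⟨Pi.single b c, fun b' => ?_, by simp⟩
  by_cases h : b' = b
  · subst h
    simpa using hc
  · simpa [h] using zero_mem_age b'

lemma smul_mem_sage (hc : c ∈ Sage1 α) {t : ℝ} (ht : 0 ≤ t) : t • c ∈ Sage1 α := by
  obtain ⟨f, hf, rfl⟩ := hc
  exact ⟨fun b => t • f b, fun b => smul_mem_age (hf b) ht, Finset.smul_sum⟩

/-- A first-order optimality condition at `x₀` certifies membership in the AGE cone. -/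
lemma mem_age_of_tangent {b : Fin m} (hc : ∀ j, j ≠ b → 0 ≤ c j) {x₀ : ℝ}
    (h0 : expSum α c x₀ = 0) (h1 : 0 ≤ expSumDeriv α c x₀)
    (h2 : x₀ = 0 ∨ expSumDeriv α c x₀ = 0) : c ∈ AgeCone1 α b := by
  refine ⟨hc, fun x hx => ?_⟩
  have hD : 0 ≤ expSumDeriv α c x₀ * (x - x₀) := by
    rcases h2 with h2 | h2
    · subst h2
      exact mul_nonneg h1 (by linarith)
    · simp [h2]
  have key : expSumDeriv α c x₀ * (x - x₀) ≤
      (∑ j, c j * Real.exp (α j * x)) * Real.exp (-(α b * (x - x₀))) := by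
    have e1 : expSumDeriv α c x₀ * (x - x₀) = ∑ j, c j * Real.exp (α j * x₀) *
        (1 + (α j - α b) * (x - x₀)) := by
      have : ∑ j, c j * Real.exp (α j * x₀) * (1 + (α j - α b) * (x - x₀)) =
          expSum α c x₀ * (1 - α b * (x - x₀)) + expSumDeriv α c x₀ * (x - x₀) := by
        simp only [expSum, expSumDeriv, Finset.sum_mul, ← Finset.sum_add_distrib]
        exact Finset.sum_congr rfl fun j _ => by ring
      rw [this, h0]
      ring
    rw [e1, Finset.sum_mul]
    refine Finset.sum_le_sum fun j _ => ?_
    have e2 : c j * Real.exp (α j * x) * Real.exp (-(α b * (x - x₀))) =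
        c j * Real.exp (α j * x₀) * Real.exp ((α j - α b) * (x - x₀)) := by
      rw [mul_assoc, mul_assoc, ← Real.exp_add, ← Real.exp_add]
      ring_nf
    rw [e2]
    by_cases hj : j = b
    · simp [hj]
    · refine mul_le_mul_of_nonneg_left ?_ (mul_nonneg (hc j hj) (Real.exp_pos _).le)
      linarith [Real.add_one_le_exp ((α j - α b) * (x - x₀))]
  exact nonneg_of_mul_nonneg_left (hD.trans key) (Real.exp_pos _)

lemma circuitVec_mem_age (hmono : StrictMono α) {x₀ : ℝ} {p q k : Fin m} (hpq : p < q)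
    (hqk : q < k) : circuitVec α x₀ p q k ∈ AgeCone1 α q := by
  refine mem_age_of_tangent (fun j hj => ?_) (expSum_circuitVec α x₀ p q k)
    (expSumDeriv_circuitVec α x₀ p q k).ge (Or.inr (expSumDeriv_circuitVec α x₀ p q k))
  have h1 := hmono hpq
  have h2 := hmono hqk
  simp only [circuitVec, Pi.add_apply, Pi.sub_apply, Pi.single_apply, if_neg hj, sub_zero]
  refine add_nonneg ?_ ?_ <;> split_ifs <;>
    first | exact le_rfl | exact mul_nonneg (by linarith) (Real.exp_pos _).le

lemma single_sub_single_mem_age (hmono : StrictMono α) {p q : Fin m} (hpq : p < q) :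
    (Pi.single q 1 - Pi.single p 1 : Fin m → ℝ) ∈ AgeCone1 α p := by
  refine mem_age_of_tangent (x₀ := 0) (fun j hj => ?_) ?_ ?_ (Or.inl rfl)
  · simp only [Pi.sub_apply, Pi.single_apply, if_neg hj]
    split_ifs <;> simp
  · simp [expSum_sub, expSum_single]
  · simp [expSumDeriv_sub, expSumDeriv_single, (hmono hpq).le]

/-- If a sum of SAGE functions has a double zero at `x₀ ≥ 0`, so do all AGE summands. -/
lemma exists_age_double_zero {u w : Fin m → ℝ} (hu : u ∈ Sage1 α) (hw : w ∈ Sage1 α)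
    {x₀ : ℝ} (hx₀ : 0 ≤ x₀) (h0 : expSum α (u + w) x₀ = 0)
    (h1 : expSumDeriv α (u + w) x₀ = 0) :
    ∃ f : Fin m → Fin m → ℝ, (∀ b, f b ∈ AgeCone1 α b) ∧ u = ∑ b, f b ∧
      ∀ b, expSum α (f b) x₀ = 0 ∧ expSumDeriv α (f b) x₀ = 0 := by
  rw [expSum_add] at h0
  rw [expSumDeriv_add] at h1
  have hu0 := expSum_nonneg_of_mem_sage hu x₀ hx₀
  have hw0 := expSum_nonneg_of_mem_sage hw x₀ hx₀
  have hu0' : expSum α u x₀ = 0 := by linarith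
  have hw0' : expSum α w x₀ = 0 := by linarith
  have hu1 := expSumDeriv_nonneg (expSum_nonneg_of_mem_sage hu) hx₀ hu0'
  have hw1 := expSumDeriv_nonneg (expSum_nonneg_of_mem_sage hw) hx₀ hw0'
  have hu1' : expSumDeriv α u x₀ = 0 := by linarith
  obtain ⟨f, hf, rfl⟩ := hu
  rw [expSum_sum] at hu0'
  rw [expSumDeriv_sum] at hu1'
  have hz : ∀ b, expSum α (f b) x₀ = 0 := fun b =>
    (Finset.sum_eq_zero_iff_of_nonneg fun b _ => (hf b).2 x₀ hx₀).1 hu0' b (Finset.mem_univ b)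
  have hz' : ∀ b, expSumDeriv α (f b) x₀ = 0 := fun b =>
    (Finset.sum_eq_zero_iff_of_nonneg fun b _ =>
      expSumDeriv_nonneg (hf b).2 hx₀ (hz b)).1 hu1' b (Finset.mem_univ b)
  exact ⟨f, hf, rfl, fun b => ⟨hz b, hz' b⟩⟩

/-- Hinge functionals are nonnegative on AGE functions with a double zero (Jensen). -/
lemma hinge_nonneg_of_mem_age {b : Fin m} (hc : c ∈ AgeCone1 α b) {x₀ : ℝ}
    (h0 : expSum α c x₀ = 0) (h1 : expSumDeriv α c x₀ = 0) (y : ℝ) :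
    0 ≤ ∑ j, c j * Real.exp (α j * x₀) * max (y - α j) 0 := by
  have hlin : ∑ j, c j * Real.exp (α j * x₀) * (y - α j) = 0 := by
    have : ∑ j, c j * Real.exp (α j * x₀) * (y - α j) =
        expSum α c x₀ * y - expSumDeriv α c x₀ := by
      simp only [expSum, expSumDeriv, Finset.sum_mul, ← Finset.sum_sub_distrib]
      exact Finset.sum_congr rfl fun j _ => by ring
    rw [this, h0, h1]
    ring
  rcases le_total y (α b) with hy | hy
  · refine Finset.sum_nonneg fun j _ => ?_
    by_cases hj : j = b
    · subst hj
      simp [hy]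
    · exact mul_nonneg (mul_nonneg (hc.1 j hj) (Real.exp_pos _).le) (le_max_right _ _)
  · rw [← hlin]
    refine Finset.sum_le_sum fun j _ => ?_
    by_cases hj : j = b
    · subst hj
      rw [max_eq_left (by linarith)]
    · exact mul_le_mul_of_nonneg_left (le_max_left _ _)
        (mul_nonneg (hc.1 j hj) (Real.exp_pos _).le)

lemma hinge_nonneg_of_mem_sage {u w : Fin m → ℝ} (hu : u ∈ Sage1 α) (hw : w ∈ Sage1 α)
    {x₀ : ℝ} (hx₀ : 0 ≤ x₀) (h0 : expSum α (u + w) x₀ = 0)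
    (h1 : expSumDeriv α (u + w) x₀ = 0) (y : ℝ) :
    0 ≤ ∑ j, u j * Real.exp (α j * x₀) * max (y - α j) 0 := by
  obtain ⟨f, hf, rfl, hz⟩ := exists_age_double_zero hu hw hx₀ h0 h1
  simp only [Finset.sum_apply, Finset.sum_mul]
  rw [Finset.sum_comm]
  exact Finset.sum_nonneg fun b _ => hinge_nonneg_of_mem_age (hf b) (hz b).1 (hz b).2 y

lemma eq_zero_below_of_mem_sage (hmono : StrictMono α) {u w : Fin m → ℝ} (hu : u ∈ Sage1 α)
    (hw : w ∈ Sage1 α) {x₀ : ℝ} (hx₀ : 0 ≤ x₀) (h0 : expSum α (u + w) x₀ = 0)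
    (h1 : expSumDeriv α (u + w) x₀ = 0) {p : Fin m} (hp : ∀ j, j < p → u j + w j = 0) :
    ∀ j, j < p → u j = 0 := by
  have hinge : ∀ q ≤ p, ∑ j, u j * Real.exp (α j * x₀) * max (α q - α j) 0 = 0 := by
    intro q hq
    have a1 := hinge_nonneg_of_mem_sage hu hw hx₀ h0 h1 (α q)
    have a2 := hinge_nonneg_of_mem_sage hw hu hx₀ (add_comm u w ▸ h0) (add_comm u w ▸ h1) (α q)
    have a3 : ∑ j, u j * Real.exp (α j * x₀) * max (α q - α j) 0 +
        ∑ j, w j * Real.exp (α j * x₀) * max (α q - α j) 0 = 0 := by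
      rw [← Finset.sum_add_distrib]
      refine Finset.sum_eq_zero fun j _ => ?_
      rcases lt_or_ge j q with h | h
      · linear_combination Real.exp (α j * x₀) * max (α q - α j) 0 * hp j (h.trans_le hq)
      · rw [max_eq_right (by linarith [hmono.monotone h])]
        ring
    linarith
  intro j
  induction j using WellFoundedLT.induction with
  | ind j ih =>
    intro hj
    obtain ⟨q, hq⟩ : ∃ q : Fin m, q.val = j.val + 1 :=
      ⟨⟨j.val + 1, by have := p.isLt; have := Fin.lt_def.1 hj; omega⟩, rfl⟩
    have hjq : j < q := Fin.lt_def.2 (by omega)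
    have hqp : q ≤ p := Fin.le_def.2 (by have := Fin.lt_def.1 hj; omega)
    have h := hinge q hqp
    rw [Finset.sum_eq_single j] at h
    · have hpos : 0 < Real.exp (α j * x₀) * max (α q - α j) 0 :=
        mul_pos (Real.exp_pos _) (lt_max_of_lt_left (sub_pos.2 (hmono hjq)))
      rw [mul_assoc] at h
      exact (mul_eq_zero.1 h).resolve_right hpos.ne'
    · intro l _ hl
      rcases lt_or_gt_of_ne hl with hl | hl
      · simp [ih l hl (hl.trans hj)]
      · have : q ≤ l := Fin.le_def.2 (by have := Fin.lt_def.1 hl; omega)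
        rw [max_eq_right (by linarith [hmono.monotone this]), mul_zero]
    · simp

end Cones

section EdgeGenerators

variable {m : ℕ} {α : Fin m → ℝ} {c : Fin m → ℝ}

lemma isEdgeGenerator_sage_of_left (h0 : c ≠ 0) (hc : c ∈ Sage1 α)
    (h : ∀ u ∈ Sage1 α, ∀ w ∈ Sage1 α, c = u + w → ∃ a : ℝ, 0 ≤ a ∧ u = a • c) :
    IsEdgeGenerator (Sage1 α) c :=
  ⟨h0, hc, fun u hu w hw e => ⟨h u hu w hw e, h w hw u hu (e.trans (add_comm u w))⟩⟩

lemma IsEdgeGenerator.smul_sage (h : IsEdgeGenerator (Sage1 α) c) {t : ℝ} (ht : 0 < t) :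
    IsEdgeGenerator (Sage1 α) (t • c) := by
  refine isEdgeGenerator_sage_of_left (smul_ne_zero ht.ne' h.1) (smul_mem_sage h.2.1 ht.le) ?_
  intro u hu w hw e
  have ht' := inv_nonneg.2 ht.le
  obtain ⟨⟨a, ha, hua⟩, -⟩ := h.2.2 _ (smul_mem_sage hu ht') _ (smul_mem_sage hw ht')
    (by rw [← smul_add, ← e, inv_smul_smul₀ ht.ne'])
  refine ⟨a, ha, ?_⟩
  rw [smul_comm, ← hua, smul_inv_smul₀ ht.ne']

lemma isEdgeGenerator_single (hmono : StrictMono α) {z : Fin m} (hz : z.val = 0) :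
    IsEdgeGenerator (Sage1 α) (Pi.single z 1) := by
  refine isEdgeGenerator_sage_of_left (by simp) (mem_sage_of_mem_age
    (mem_age_of_nonneg (fun j => ?_) z)) fun u hu w hw e => ?_
  · rw [Pi.single_apply]
    split_ifs <;> simp
  have hu' := expSum_nonneg_of_mem_sage hu
  have hab := eq_zero_of_add_eq_zero_above hmono hu' (expSum_nonneg_of_mem_sage hw) (p := z)
    fun j hj => by
      have := congrFun e j
      rw [Pi.single_eq_of_ne hj.ne'] at this
      exact this.symm
  refine ⟨u z, coeff_nonneg_of_top hmono hu' fun j hj => (hab j hj).1, ?_⟩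
  ext j
  rcases eq_or_ne j z with rfl | hj
  · simp
  · have : z < j := Fin.lt_def.2 (by have := Fin.val_ne_of_ne hj; omega)
    simp [hj, (hab j this).1]

lemma isEdgeGenerator_single_sub_single (hmono : StrictMono α) {z o : Fin m} (hz : z.val = 0)
    (ho : o.val = 1) : IsEdgeGenerator (Sage1 α) (Pi.single o 1 - Pi.single z 1) := by
  have hzo : z < o := Fin.lt_def.2 (by omega)
  refine isEdgeGenerator_sage_of_left (fun h => ?_) (mem_sage_of_mem_age
    (single_sub_single_mem_age hmono hzo)) fun u hu w hw e => ?_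
  · simpa [hzo.ne'] using congrFun h o
  have hu' := expSum_nonneg_of_mem_sage hu
  have hw' := expSum_nonneg_of_mem_sage hw
  have hj : ∀ j, o < j → j ≠ o ∧ j ≠ z := fun j hj => ⟨hj.ne', (hzo.trans hj).ne'⟩
  have hab := eq_zero_of_add_eq_zero_above hmono hu' hw' (p := o)
    fun j h => by
      have := congrFun e j
      simp [hj j h] at this
      exact this.symm
  have hsupp : u = Pi.single o (u o) + Pi.single z (u z) := by
    ext j
    rcases eq_or_ne j o with rfl | h1
    · simp [hzo.ne']
    rcases eq_or_ne j z with rfl | h2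
    · simp [hzo.ne]
    have : o < j := Fin.lt_def.2 (by
      have := Fin.val_ne_of_ne h1; have := Fin.val_ne_of_ne h2; omega)
    simp [h1, h2, (hab j this).1]
  have h0 : expSum α u 0 + expSum α w 0 = 0 := by
    rw [← expSum_add, ← e, expSum_sub, expSum_single, expSum_single]
    simp
  have h1 : expSum α u 0 = 0 := by linarith [hu' 0 le_rfl, hw' 0 le_rfl]
  rw [hsupp, expSum_add, expSum_single, expSum_single] at h1
  simp only [mul_zero, Real.exp_zero, mul_one] at h1
  refine ⟨u o, coeff_nonneg_of_top hmono hu' fun j hj => (hab j hj).1, ?_⟩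
  have h2 : u z = -u o := by linarith
  conv_lhs => rw [hsupp, h2]
  ext j
  simp only [Pi.add_apply, Pi.smul_apply, Pi.sub_apply, Pi.single_apply, smul_eq_mul]
  split_ifs <;> ring

lemma eq_zero_of_expSum_pair (hmono : StrictMono α) {x₀ a b : ℝ} {p q : Fin m} (hpq : p < q)
    (h0 : expSum α (Pi.single p a + Pi.single q b) x₀ = 0)
    (h1 : expSumDeriv α (Pi.single p a + Pi.single q b) x₀ = 0) : a = 0 ∧ b = 0 := by
  simp only [expSum_add, expSum_single] at h0
  simp only [expSumDeriv_add, expSumDeriv_single] at h1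
  have hd := sub_pos.2 (hmono hpq)
  have ha : a * ((α q - α p) * Real.exp (α p * x₀)) = 0 := by
    linear_combination α q * h0 - h1
  have hb : b * ((α q - α p) * Real.exp (α q * x₀)) = 0 := by
    linear_combination h1 - α p * h0
  exact ⟨(mul_eq_zero.1 ha).resolve_right (mul_pos hd (Real.exp_pos _)).ne',
    (mul_eq_zero.1 hb).resolve_right (mul_pos hd (Real.exp_pos _)).ne'⟩

lemma circuitVec_apply_left {x₀ : ℝ} {p q k : Fin m} (hpq : p < q) (hqk : q < k) :
    circuitVec α x₀ p q k p = (α k - α q) * Real.exp (-(α p * x₀)) := by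
  simp [circuitVec, hpq.ne, (hpq.trans hqk).ne]

lemma circuitVec_apply_mid {x₀ : ℝ} {p q k : Fin m} (hpq : p < q) (hqk : q < k) :
    circuitVec α x₀ p q k q = -((α k - α p) * Real.exp (-(α q * x₀))) := by
  simp [circuitVec, hpq.ne', hqk.ne]

lemma circuitVec_apply_right {x₀ : ℝ} {p q k : Fin m} (hpq : p < q) (hqk : q < k) :
    circuitVec α x₀ p q k k = (α q - α p) * Real.exp (-(α k * x₀)) := by
  simp [circuitVec, hqk.ne', (hpq.trans hqk).ne']

lemma circuitVec_apply_of_ne {x₀ : ℝ} {p q k j : Fin m} (hp : j ≠ p) (hq : j ≠ q) (hk : j ≠ k) :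
    circuitVec α x₀ p q k j = 0 := by
  simp [circuitVec, hp, hq, hk]

lemma isEdgeGenerator_circuitVec (hmono : StrictMono α) {x₀ : ℝ} (hx₀ : 0 ≤ x₀) {p q k : Fin m}
    (hpq : p.val + 1 = q.val) (hqk : q.val + 1 = k.val) :
    IsEdgeGenerator (Sage1 α) (circuitVec α x₀ p q k) := by
  have hpq' : p < q := Fin.lt_def.2 (by omega)
  have hqk' : q < k := Fin.lt_def.2 (by omega)
  set r := circuitVec α x₀ p q k with hr
  have hrk : 0 < r k := by
    rw [hr, circuitVec_apply_right hpq' hqk']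
    exact mul_pos (sub_pos.2 (hmono hpq')) (Real.exp_pos _)
  refine isEdgeGenerator_sage_of_left (fun h => hrk.ne' (congrFun h k)) (mem_sage_of_mem_age
    (circuitVec_mem_age hmono hpq' hqk')) fun u hu w hw e => ?_
  have hu' := expSum_nonneg_of_mem_sage hu
  have habove : ∀ j, k < j → u j = 0 := fun j hj =>
    (eq_zero_of_add_eq_zero_above hmono hu' (expSum_nonneg_of_mem_sage hw) (p := k) (fun j hj => by
      have h := congrFun e j
      rw [hr, circuitVec_apply_of_ne (hpq'.trans (hqk'.trans hj)).ne' (hqk'.trans hj).ne'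
        hj.ne'] at h
      exact h.symm) j hj).1
  have h0 : expSum α (u + w) x₀ = 0 := by rw [← e, hr, expSum_circuitVec]
  have h1 : expSumDeriv α (u + w) x₀ = 0 := by rw [← e, hr, expSumDeriv_circuitVec]
  have hbelow : ∀ j, j < p → u j = 0 :=
    eq_zero_below_of_mem_sage hmono hu hw hx₀ h0 h1 fun j hj => by
      have h := congrFun e j
      rw [hr, circuitVec_apply_of_ne hj.ne (hj.trans hpq').ne (hj.trans (hpq'.trans hqk')).ne] at h
      exact h.symm
  obtain ⟨f, -, hf, hz⟩ := exists_age_double_zero hu hw hx₀ h0 h1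
  have hu0 : expSum α u x₀ = 0 := by
    rw [hf, expSum_sum]
    exact Finset.sum_eq_zero fun b _ => (hz b).1
  have hu1 : expSumDeriv α u x₀ = 0 := by
    rw [hf, expSumDeriv_sum]
    exact Finset.sum_eq_zero fun b _ => (hz b).2
  set s := u k / r k with hs
  have hsk : u k = s * r k := by rw [hs, div_mul_cancel₀ _ hrk.ne']
  have hd : u - s • r = Pi.single p ((u - s • r) p) + Pi.single q ((u - s • r) q) := by
    ext j
    rcases eq_or_ne j p with rfl | h1
    · simp [hpq'.ne]
    rcases eq_or_ne j q with rfl | h2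
    · simp [hpq'.ne']
    rcases eq_or_ne j k with rfl | h3
    · simp [h1, h2, hsk]
    have hj : u j = 0 := by
      have e1 := Fin.val_ne_of_ne h1
      have e2 := Fin.val_ne_of_ne h2
      have e3 := Fin.val_ne_of_ne h3
      rcases lt_or_gt_of_ne h1 with h | h
      · exact hbelow j h
      · exact habove j (Fin.lt_def.2 (by have := Fin.lt_def.1 h; omega))
    have hrj : r j = 0 := by rw [hr, circuitVec_apply_of_ne h1 h2 h3]
    simp [h1, h2, hj, hrj]
  obtain ⟨ha, hb⟩ := eq_zero_of_expSum_pair hmono (x₀ := x₀) hpq'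
    (by rw [← hd, expSum_sub, expSum_smul, hu0, hr, expSum_circuitVec]; ring)
    (by rw [← hd, expSumDeriv_sub, expSumDeriv_smul, hu1, hr, expSumDeriv_circuitVec]; ring)
  refine ⟨s, div_nonneg (coeff_nonneg_of_top hmono hu' habove) hrk.le, ?_⟩
  rw [ha, hb, Pi.single_zero, Pi.single_zero, add_zero] at hd
  exact sub_eq_zero.1 hd

lemma IsEdgeGenerator.exists_smul_of_sub_mem {E : Type*} [AddCommGroup E] [Module ℝ E]
    {K : Set E} {v u : E} (h : IsEdgeGenerator K v) (hu : u ∈ K) (hw : v - u ∈ K) :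
    ∃ a : ℝ, 0 ≤ a ∧ u = a • v :=
  (h.2.2 u hu _ hw (add_sub_cancel u v).symm).1

lemma IsEdgeGenerator.exists_mem_age (h : IsEdgeGenerator (Sage1 α) c) :
    ∃ b, c ∈ AgeCone1 α b := by
  obtain ⟨f, hf, hcf⟩ := h.2.1
  obtain ⟨b, hb⟩ : ∃ b, f b ≠ 0 := by
    by_contra! hall
    exact h.1 (hcf.trans (Finset.sum_eq_zero fun b _ => hall b))
  have hsub : c - f b ∈ Sage1 α := by
    refine ⟨Function.update f b 0, fun b' => ?_, ?_⟩
    · rcases eq_or_ne b' b with rfl | hb'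
      · simpa using zero_mem_age b'
      · simpa [hb'] using hf b'
    · rw [Finset.sum_update_of_mem (Finset.mem_univ b), zero_add, hcf,
        ← Finset.add_sum_erase Finset.univ f (Finset.mem_univ b), add_sub_cancel_left,
        Finset.sdiff_singleton_eq_erase]
  obtain ⟨a, ha, hfa⟩ := h.exists_smul_of_sub_mem (mem_sage_of_mem_age (hf b)) hsub
  have ha' : a ≠ 0 := by
    rintro rfl
    exact hb (by simpa using hfa)
  refine ⟨b, ?_⟩
  rw [← inv_smul_smul₀ ha' c, ← hfa]
  exact smul_mem_age (hf b) (inv_nonneg.2 ha)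

/-- A nonnegative edge generator is a multiple of the exponential with smallest exponent. -/
lemma IsEdgeGenerator.eq_single_of_nonneg (hmono : StrictMono α)
    (h : IsEdgeGenerator (Sage1 α) c) (hc : ∀ j, 0 ≤ c j) {z : Fin m} (hz : z.val = 0) :
    ∃ s : ℝ, 0 < s ∧ c = s • Pi.single z 1 := by
  obtain ⟨k, hk⟩ := Function.ne_iff.1 h.1
  have hk' : 0 < c k := lt_of_le_of_ne (hc k) (Ne.symm hk)
  have hs : ∀ (p : Fin m) (y : ℝ), 0 ≤ y → (Pi.single p y : Fin m → ℝ) ∈ Sage1 α := by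
    intro p y hy
    refine mem_sage_of_mem_age (mem_age_of_nonneg (fun j => ?_) p)
    rw [Pi.single_apply]
    split_ifs
    exacts [hy, le_rfl]
  have hsub : c - Pi.single k (c k) ∈ Sage1 α := by
    refine mem_sage_of_mem_age (mem_age_of_nonneg (fun j => ?_) k)
    rcases eq_or_ne j k with rfl | hj
    · simp
    · simp [hj, hc j]
  obtain ⟨a, ha, hka⟩ := h.exists_smul_of_sub_mem (hs k _ hk'.le) hsub
  have hsupp : ∀ j, j ≠ k → c j = 0 := by
    intro j hj
    have ha' : a ≠ 0 := by
      rintro rfl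
      have := congrFun hka k
      simp at this
      exact hk this
    have := congrFun hka j
    simp [hj, ha'] at this
    exact this
  have hck : c = Pi.single k (c k) := by
    ext j
    rcases eq_or_ne j k with rfl | hj
    · simp
    · simp [hj, hsupp j hj]
  rcases eq_or_ne k z with rfl | hkz
  · refine ⟨c k, hk', ?_⟩
    conv_lhs => rw [hck]
    ext j
    simp [Pi.single_apply]
  exfalso
  have hzk : z < k := Fin.lt_def.2 (by have := Fin.val_ne_of_ne hkz; omega)
  obtain ⟨a, ha, hka⟩ := h.exists_smul_of_sub_mem (u := c k • (Pi.single k 1 - Pi.single z 1))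
    (smul_mem_sage (mem_sage_of_mem_age (single_sub_single_mem_age hmono hzk)) hk'.le) (by
      have : c - c k • (Pi.single k 1 - Pi.single z 1) = Pi.single z (c k) := by
        ext j
        conv_lhs => rw [hck]
        simp only [Pi.smul_apply, Pi.sub_apply, Pi.single_apply, smul_eq_mul]
        split_ifs <;> simp
      rw [this]
      exact hs z _ hk'.le)
  have := congrFun hka z
  simp [hzk.ne, hsupp z hzk.ne] at this
  exact hk this

/-- An AGE edge generator with a negative coefficient touches zero on `[0, ∞)`. -/
lemma IsEdgeGenerator.exists_zero (hmono : StrictMono α) (h : IsEdgeGenerator (Sage1 α) c)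
    {b : Fin m} (hc : c ∈ AgeCone1 α b) (hb : c b < 0) :
    ∃ x₀, 0 ≤ x₀ ∧ expSum α c x₀ = 0 := by
  obtain ⟨k, hbk, hk⟩ : ∃ k, b < k ∧ c k ≠ 0 := by
    by_contra! hall
    exact hb.not_ge (coeff_nonneg_of_top hmono hc.2 hall)
  have hk' : 0 < c k := lt_of_le_of_ne (hc.1 k hbk.ne') hk.symm
  set g : ℝ → ℝ := fun x => expSum α c x * Real.exp (-(α b * x)) with hg
  have hgcont : Continuous g := by
    have : Continuous (expSum α c) := by
      unfold expSum
      fun_prop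
    fun_prop
  have hglow : ∀ x, c b + c k * ((α k - α b) * x) ≤ g x := by
    intro x
    have e1 : g x = ∑ j, c j * Real.exp ((α j - α b) * x) := by
      simp only [hg, expSum, Finset.sum_mul]
      refine Finset.sum_congr rfl fun j _ => ?_
      rw [mul_assoc, ← Real.exp_add]
      ring_nf
    have e2 : ∑ j ∈ {b, k}, c j * Real.exp ((α j - α b) * x) ≤ g x := by
      rw [e1]
      refine Finset.sum_le_sum_of_subset_of_nonneg (Finset.subset_univ _) fun j _ hj => ?_
      refine mul_nonneg (hc.1 j fun hjb => hj (by simp [hjb])) (Real.exp_pos _).le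
    rw [Finset.sum_pair hbk.ne] at e2
    have e3 : (α k - α b) * x ≤ Real.exp ((α k - α b) * x) := by
      linarith [Real.add_one_le_exp ((α k - α b) * x)]
    have e4 := mul_le_mul_of_nonneg_left e3 hk'.le
    simp only [sub_self, zero_mul, Real.exp_zero, mul_one] at e2
    linarith
  have hd : 0 < c k * (α k - α b) := mul_pos hk' (sub_pos.2 (hmono hbk))
  set M := (g 0 - c b) / (c k * (α k - α b)) with hM
  have hg0 : 0 ≤ g 0 := mul_nonneg (hc.2 0 le_rfl) (Real.exp_pos _).le
  have hM0 : 0 ≤ M := div_nonneg (by linarith) hd.le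
  obtain ⟨x₀, hx₀, hmin⟩ := isCompact_Icc.exists_isMinOn (Set.nonempty_Icc.2 hM0)
    hgcont.continuousOn
  have hmin' : ∀ x, 0 ≤ x → g x₀ ≤ g x := by
    intro x hx
    rcases le_total x M with hxM | hxM
    · exact hmin ⟨hx, hxM⟩
    · have e1 : g x₀ ≤ g 0 := hmin ⟨le_rfl, hM0⟩
      have e2 : c k * (α k - α b) * M = g 0 - c b := by
        rw [hM, mul_div_cancel₀ _ hd.ne']
      have e3 := mul_le_mul_of_nonneg_left hxM hd.le
      linarith [hglow x]
  have hμ : 0 ≤ g x₀ := mul_nonneg (hc.2 x₀ hx₀.1) (Real.exp_pos _).le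
  have hsingle : (Pi.single b (g x₀) : Fin m → ℝ) ∈ Sage1 α := by
    refine mem_sage_of_mem_age (mem_age_of_nonneg (fun j => ?_) b)
    rw [Pi.single_apply]
    split_ifs
    exacts [hμ, le_rfl]
  obtain ⟨a, ha, hba⟩ := h.exists_smul_of_sub_mem hsingle (by
    refine mem_sage_of_mem_age (b := b) ⟨fun j hj => by simpa [hj] using hc.1 j hj, fun x hx => ?_⟩
    have e1 : expSum α (c - Pi.single b (g x₀)) x = (g x - g x₀) * Real.exp (α b * x) := by
      have : Real.exp (-(α b * x)) * Real.exp (α b * x) = 1 := by rw [← Real.exp_add]; simp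
      rw [expSum_sub, expSum_single, sub_mul]
      simp only [hg]
      linear_combination (-expSum α c x) * this
    exact (mul_nonneg (sub_nonneg.2 (hmin' x hx)) (Real.exp_pos _).le).trans_eq e1.symm)
  have hbb := congrFun hba b
  simp only [Pi.single_eq_same, Pi.smul_apply, smul_eq_mul] at hbb
  have hμ0 : g x₀ = 0 := le_antisymm (hbb.trans_le (mul_nonpos_of_nonneg_of_nonpos ha hb.le)) hμ
  exact ⟨x₀, hx₀.1, (mul_eq_zero.1 hμ0).resolve_right (Real.exp_pos _).ne'⟩

/-- An edge generator is proportional to any SAGE vector that can be peeled off it. -/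
lemma IsEdgeGenerator.eq_smul_of_peel (h : IsEdgeGenerator (Sage1 α) c) {b : Fin m}
    (hc : ∀ j, j ≠ b → 0 ≤ c j) {x₀ : ℝ} (h0 : expSum α c x₀ = 0)
    (h1 : 0 ≤ expSumDeriv α c x₀) (h2 : x₀ = 0 ∨ expSumDeriv α c x₀ = 0) {r : Fin m → ℝ}
    (hr : r ∈ Sage1 α) (hr0 : r ≠ 0) (hrE : expSum α r x₀ = 0)
    (hrD : 0 ≤ expSumDeriv α r x₀) (hrD' : 0 < expSumDeriv α r x₀ → 0 < expSumDeriv α c x₀)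
    (hpos : ∀ j, j ≠ b → 0 < r j → 0 < c j) : ∃ s : ℝ, 0 < s ∧ c = s • r := by
  have small : ∀ y z : ℝ, 0 ≤ z → (0 < y → 0 < z) →
      ∀ᶠ ε in nhdsWithin (0 : ℝ) (Set.Ioi 0), 0 ≤ z - ε * y := by
    intro y z hz hyz
    rcases le_or_gt y 0 with hy | hy
    · filter_upwards [self_mem_nhdsWithin] with ε hε
      nlinarith [mul_nonneg (le_of_lt (Set.mem_Ioi.1 hε)) (neg_nonneg.2 hy)]
    · have hcont : Filter.Tendsto (fun ε : ℝ => z - ε * y) (nhds 0) (nhds (z - 0 * y)) :=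
        Continuous.tendsto (by fun_prop) 0
      rw [zero_mul, sub_zero] at hcont
      filter_upwards [(hcont.mono_left nhdsWithin_le_nhds).eventually (lt_mem_nhds (hyz hy))]
        with ε hε using hε.le
  have hev : ∀ᶠ ε in nhdsWithin (0 : ℝ) (Set.Ioi 0), ∀ j, j ≠ b → 0 ≤ c j - ε * r j := by
    refine Filter.eventually_all.2 fun j => ?_
    by_cases hj : j = b
    · exact Filter.Eventually.of_forall fun ε hne => absurd hj hne
    · filter_upwards [small (r j) (c j) (hc j hj) (hpos j hj)] with ε hε _ using hε
  obtain ⟨ε, ⟨hε1, hε2⟩, hε⟩ := ((hev.and (small _ _ h1 hrD')).and self_mem_nhdsWithin).exists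
  have hD : expSumDeriv α (c - ε • r) x₀ = expSumDeriv α c x₀ - ε * expSumDeriv α r x₀ := by
    rw [expSumDeriv_sub, expSumDeriv_smul]
  obtain ⟨a, ha, hea⟩ := h.exists_smul_of_sub_mem (smul_mem_sage hr hε.le)
    (mem_sage_of_mem_age (b := b) (mem_age_of_tangent (x₀ := x₀) hε1
      (by rw [expSum_sub, expSum_smul, h0, hrE]; ring) (hD ▸ hε2) (by
        refine h2.imp_right fun h2 => ?_
        have : expSumDeriv α r x₀ = 0 := by
          by_contra hne
          exact (hrD' (lt_of_le_of_ne hrD (Ne.symm hne))).ne' h2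
        rw [hD, h2, this]
        ring)))
  have ha' : a ≠ 0 := by
    rintro rfl
    rw [zero_smul] at hea
    exact (smul_ne_zero hε.ne' hr0) hea
  refine ⟨a⁻¹ * ε, mul_pos (inv_pos.2 (lt_of_le_of_ne ha ha'.symm)) hε, ?_⟩
  rw [mul_smul, hea, inv_smul_smul₀ ha']

/-- Edge generators with a strictly positive slope at the zero `0`. -/
lemma IsEdgeGenerator.eq_pair_of_deriv_pos (hmono : StrictMono α)
    (h : IsEdgeGenerator (Sage1 α) c) {b : Fin m} (hc : ∀ j, j ≠ b → 0 ≤ c j) (hb : c b < 0)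
    (h0 : expSum α c 0 = 0) (h1 : 0 < expSumDeriv α c 0) {z o : Fin m} (hz : z.val = 0)
    (ho : o.val = 1) : ∃ s : ℝ, 0 < s ∧ c = s • (Pi.single o 1 - Pi.single z 1) := by
  have peel : ∀ p q : Fin m, p < q → (q ≠ b → 0 < c q) →
      ∃ s : ℝ, 0 < s ∧ c = s • (Pi.single q 1 - Pi.single p 1) := by
    intro p q hpq hq
    refine h.eq_smul_of_peel hc h0 h1.le (Or.inl rfl)
      (mem_sage_of_mem_age (single_sub_single_mem_age hmono hpq)) ?_ ?_ ?_ (fun _ => h1) ?_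
    · intro h
      simpa [hpq.ne'] using congrFun h q
    · simp [expSum_sub, expSum_single]
    · simp [expSumDeriv_sub, expSumDeriv_single, (hmono hpq).le]
    · intro j hj hrj
      rcases eq_or_ne j q with rfl | hjq
      · exact hq hj
      · exfalso
        simp only [Pi.sub_apply, Pi.single_apply, if_neg hjq] at hrj
        split_ifs at hrj <;> linarith
  obtain ⟨k, hbk, hk⟩ : ∃ k, b < k ∧ 0 < c k := by
    by_contra! hall
    have : expSumDeriv α c 0 ≤ expSum α c 0 * α b := by
      simp only [expSumDeriv, expSum, Finset.sum_mul, mul_zero, Real.exp_zero, mul_one]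
      refine Finset.sum_le_sum fun j _ => ?_
      rcases lt_trichotomy j b with hj | rfl | hj
      · exact mul_le_mul_of_nonneg_left (hmono hj).le (hc j hj.ne)
      · exact le_rfl
      · simp [le_antisymm (hall j hj) (hc j hj.ne')]
    rw [h0] at this
    linarith
  have hbz : b = z := by
    by_contra hbz
    have hzb : z < b := Fin.lt_def.2 (by have := Fin.val_ne_of_ne hbz; omega)
    obtain ⟨s, hs, hcs⟩ := peel z b hzb (fun hne => absurd rfl hne)
    have := congrFun hcs b
    simp [hzb.ne'] at this
    linarith
  subst hbz
  have hko : k = o := by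
    by_contra hko
    have hk1 := Fin.lt_def.1 hbk
    have hok : o < k := Fin.lt_def.2 (by have := Fin.val_ne_of_ne hko; omega)
    have hbo : b < o := Fin.lt_def.2 (by omega)
    obtain ⟨s, hs, hcs⟩ := peel o k hok (fun _ => hk)
    have := congrFun hcs b
    simp [hbk.ne, hbo.ne] at this
    linarith
  subst hko
  exact peel b k hbk fun _ => hk

/-- Edge generators with a double zero. -/
lemma IsEdgeGenerator.eq_circuitVec_of_deriv_eq_zero (hmono : StrictMono α)
    (h : IsEdgeGenerator (Sage1 α) c) {b : Fin m} (hc : ∀ j, j ≠ b → 0 ≤ c j) (hb : c b < 0)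
    {x₀ : ℝ} (h0 : expSum α c x₀ = 0) (h1 : expSumDeriv α c x₀ = 0) :
    ∃ (p k : Fin m) (s : ℝ), p.val + 1 = b.val ∧ b.val + 1 = k.val ∧ 0 < s ∧
      c = s • circuitVec α x₀ p b k := by
  have peel : ∀ p q k : Fin m, p < q → q < k → (p ≠ b → 0 < c p) → (k ≠ b → 0 < c k) →
      ∃ s : ℝ, 0 < s ∧ c = s • circuitVec α x₀ p q k := by
    intro p q k hpq hqk hp hk
    have hrD := expSumDeriv_circuitVec α x₀ p q k
    refine h.eq_smul_of_peel hc h0 h1.ge (Or.inr h1)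
      (mem_sage_of_mem_age (circuitVec_mem_age hmono hpq hqk)) ?_ (expSum_circuitVec α x₀ p q k)
      hrD.ge (fun hlt => absurd hrD hlt.ne') ?_
    · intro h
      have := congrFun h k
      rw [circuitVec_apply_right hpq hqk] at this
      exact (mul_pos (sub_pos.2 (hmono hpq)) (Real.exp_pos _)).ne' this
    · intro j hj hrj
      rcases eq_or_ne j p with rfl | hjp
      · exact hp hj
      rcases eq_or_ne j k with rfl | hjk
      · exact hk hj
      exfalso
      rcases eq_or_ne j q with rfl | hjq
      · rw [circuitVec_apply_mid hpq hqk] at hrj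
        have := mul_pos (sub_pos.2 (hmono (hpq.trans hqk))) (Real.exp_pos (-(α j * x₀)))
        linarith
      · rw [circuitVec_apply_of_ne hjp hjq hjk] at hrj
        exact lt_irrefl 0 hrj
  have hlin : ∑ j, c j * Real.exp (α j * x₀) * (α j - α b) = 0 := by
    have : ∑ j, c j * Real.exp (α j * x₀) * (α j - α b) =
        expSumDeriv α c x₀ - expSum α c x₀ * α b := by
      simp only [expSum, expSumDeriv, Finset.sum_mul, ← Finset.sum_sub_distrib]
      exact Finset.sum_congr rfl fun j _ => by ring
    rw [this, h0, h1]
    ring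
  have hlt : c b * Real.exp (α b * x₀) < 0 := mul_neg_of_neg_of_pos hb (Real.exp_pos _)
  obtain ⟨l, hlb, hl⟩ : ∃ l, l ≠ b ∧ 0 < c l := by
    by_contra! hall
    have : expSum α c x₀ < 0 := by
      refine Finset.sum_neg' (fun j _ => ?_) ⟨b, Finset.mem_univ b, hlt⟩
      rcases eq_or_ne j b with rfl | hj
      · exact hlt.le
      · exact mul_nonpos_of_nonpos_of_nonneg (hall j hj) (Real.exp_pos _).le
    linarith
  have hterm : ∀ j, 0 < c j → 0 < c j * Real.exp (α j * x₀) := fun j hj =>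
    mul_pos hj (Real.exp_pos _)
  obtain ⟨k, hbk, hk⟩ : ∃ k, b < k ∧ 0 < c k := by
    by_contra! hall
    have hle : ∀ j ∈ Finset.univ, c j * Real.exp (α j * x₀) * (α j - α b) ≤ 0 := by
      intro j _
      rcases lt_trichotomy j b with hj | rfl | hj
      · exact mul_nonpos_of_nonneg_of_nonpos (mul_nonneg (hc j hj.ne) (Real.exp_pos _).le)
          (sub_nonpos.2 (hmono hj).le)
      · simp
      · simp [le_antisymm (hall j hj) (hc j hj.ne')]
    have hz := (Finset.sum_eq_zero_iff_of_nonpos hle).1 hlin l (Finset.mem_univ l)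
    exact mul_ne_zero (hterm l hl).ne' (sub_ne_zero.2 (hmono.injective.ne hlb)) hz
  obtain ⟨p, hpb, hp⟩ : ∃ p, p < b ∧ 0 < c p := by
    by_contra! hall
    have hle : ∀ j ∈ Finset.univ, 0 ≤ c j * Real.exp (α j * x₀) * (α j - α b) := by
      intro j _
      rcases lt_trichotomy j b with hj | rfl | hj
      · simp [le_antisymm (hall j hj) (hc j hj.ne)]
      · simp
      · exact mul_nonneg (mul_nonneg (hc j hj.ne') (Real.exp_pos _).le)
          (sub_nonneg.2 (hmono hj).le)
    have hz := (Finset.sum_eq_zero_iff_of_nonneg hle).1 hlin k (Finset.mem_univ k)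
    exact mul_ne_zero (hterm k hk).ne' (sub_ne_zero.2 (hmono.injective.ne hbk.ne')) hz
  have hadj1 : p.val + 1 = b.val := by
    by_contra hne
    have hpb' := Fin.lt_def.1 hpb
    obtain ⟨q, hq⟩ : ∃ q : Fin m, q.val = p.val + 1 := ⟨⟨p.val + 1, by omega⟩, rfl⟩
    have hpq : p < q := Fin.lt_def.2 (by omega)
    have hqb : q < b := Fin.lt_def.2 (by omega)
    obtain ⟨s, hs, hcs⟩ := peel p q b hpq hqb (fun _ => hp) (fun hne => absurd rfl hne)
    have := congrFun hcs b
    rw [Pi.smul_apply, circuitVec_apply_right hpq hqb, smul_eq_mul] at this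
    have := mul_pos hs (mul_pos (sub_pos.2 (hmono hpq)) (Real.exp_pos (-(α b * x₀))))
    linarith
  have hadj2 : b.val + 1 = k.val := by
    by_contra hne
    have hbk' := Fin.lt_def.1 hbk
    obtain ⟨q, hq⟩ : ∃ q : Fin m, q.val = b.val + 1 := ⟨⟨b.val + 1, by omega⟩, rfl⟩
    have hbq : b < q := Fin.lt_def.2 (by omega)
    have hqk : q < k := Fin.lt_def.2 (by omega)
    obtain ⟨s, hs, hcs⟩ := peel b q k hbq hqk (fun hne => absurd rfl hne) (fun _ => hk)
    have := congrFun hcs b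
    rw [Pi.smul_apply, circuitVec_apply_left hbq hqk, smul_eq_mul] at this
    have := mul_pos hs (mul_pos (sub_pos.2 (hmono hqk)) (Real.exp_pos (-(α b * x₀))))
    linarith
  obtain ⟨s, hs, hcs⟩ := peel p b k hpb hbk (fun _ => hp) (fun _ => hk)
  exact ⟨p, k, s, hadj1, hadj2, hs, hcs⟩

/-- Classification of edge generators in terms of `circuitVec`. -/
lemma isEdgeGenerator_sage_iff (hmono : StrictMono α) {z o : Fin m} (hz : z.val = 0)
    (ho : o.val = 1) : IsEdgeGenerator (Sage1 α) c ↔ ∃ s : ℝ, 0 < s ∧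
      (c = s • Pi.single z 1 ∨ c = s • (Pi.single o 1 - Pi.single z 1) ∨
        ∃ (p q k : Fin m) (x₀ : ℝ), p.val + 1 = q.val ∧ q.val + 1 = k.val ∧ 0 ≤ x₀ ∧
          c = s • circuitVec α x₀ p q k) := by
  constructor
  · intro h
    obtain ⟨b, hc⟩ := h.exists_mem_age
    rcases le_or_gt 0 (c b) with hb | hb
    · obtain ⟨s, hs, hcs⟩ := h.eq_single_of_nonneg hmono (fun j => by
        rcases eq_or_ne j b with rfl | hj
        exacts [hb, hc.1 j hj]) hz
      exact ⟨s, hs, Or.inl hcs⟩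
    obtain ⟨x₀, hx₀, h0⟩ := h.exists_zero hmono hc hb
    by_cases h1 : expSumDeriv α c x₀ = 0
    · obtain ⟨p, k, s, hpb, hbk, hs, hcs⟩ := h.eq_circuitVec_of_deriv_eq_zero hmono hc.1 hb h0 h1
      exact ⟨s, hs, Or.inr (Or.inr ⟨p, b, k, x₀, hpb, hbk, hx₀, hcs⟩)⟩
    · have hx : x₀ = 0 := by
        by_contra hne
        exact h1 (expSumDeriv_eq_zero hc.2 (lt_of_le_of_ne hx₀ (Ne.symm hne)) h0)
      subst hx
      have h1' := lt_of_le_of_ne (expSumDeriv_nonneg hc.2 le_rfl h0) (Ne.symm h1)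
      obtain ⟨s, hs, hcs⟩ := h.eq_pair_of_deriv_pos hmono hc.1 hb h0 h1' hz ho
      exact ⟨s, hs, Or.inr (Or.inl hcs)⟩
  · rintro ⟨s, hs, rfl | rfl | ⟨p, q, k, x₀, hpq, hqk, hx₀, rfl⟩⟩
    · exact (isEdgeGenerator_single hmono hz).smul_sage hs
    · exact (isEdgeGenerator_single_sub_single hmono hz ho).smul_sage hs
    · exact (isEdgeGenerator_circuitVec hmono hx₀ hpq hqk).smul_sage hs

end EdgeGenerators

/-- The circuit number of the coefficients `s (k - q) e^{-px}` and `s (q - p) e^{-kx}`. -/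
lemma circuit_number_eq {p q k x s : ℝ} (hpq : p < q) (hqk : q < k) (hs : 0 < s) :
    (s * ((k - q) * Real.exp (-(p * x))) / ((k - q) / (k - p))) ^ ((k - q) / (k - p)) *
      (s * ((q - p) * Real.exp (-(k * x))) / ((q - p) / (k - p))) ^ ((q - p) / (k - p)) =
    s * ((k - p) * Real.exp (-(q * x))) := by
  have h1 : k - q ≠ 0 := by linarith
  have h2 : q - p ≠ 0 := by linarith
  have h3 : 0 < k - p := by linarith
  have e1 : ∀ y d : ℝ, d ≠ 0 → s * (d * Real.exp y) / (d / (k - p)) =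
      s * (k - p) * Real.exp y := by
    intro y d hd
    field_simp
  have hpos : 0 < s * (k - p) := mul_pos hs h3
  rw [e1 _ _ h1, e1 _ _ h2, Real.mul_rpow hpos.le (Real.exp_pos _).le,
    Real.mul_rpow hpos.le (Real.exp_pos _).le, mul_mul_mul_comm, ← Real.rpow_add hpos,
    ← Real.exp_mul, ← Real.exp_mul, ← Real.exp_add]
  have e2 : (k - q) / (k - p) + (q - p) / (k - p) = 1 := by field_simp; ring
  have e3 : -(p * x) * ((k - q) / (k - p)) + -(k * x) * ((q - p) / (k - p)) = -(q * x) := by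
    field_simp
    ring
  rw [e2, e3, Real.rpow_one, mul_assoc]

theorem statement18 {m : ℕ} (hm : 2 ≤ m) (α : Fin m → ℝ) (hmono : StrictMono α)
    (c : Fin m → ℝ) :
    IsEdgeGenerator (Sage1 α) c ↔
      ∃ t : ℝ, 0 < t ∧
        (c = t • (fun j : Fin m => if j.val = 0 then (1:ℝ) else 0) ∨
         c = t • (fun j : Fin m => if j.val = 1 then (1:ℝ)
                   else if j.val = 0 then -1 else 0) ∨
         ∃ (i : ℕ) (h1 : 1 ≤ i) (h2 : i + 1 < m) (a bb : ℝ),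
           0 < a ∧ 0 < bb ∧
           lamMinus α i h1 h2 / lamPlus α i h1 h2 ≤ a / bb ∧
           c = t • (fun j : Fin m =>
             if j.val = i - 1 then a
             else if j.val = i then
               -((a / lamMinus α i h1 h2) ^ (lamMinus α i h1 h2) *
                 (bb / lamPlus α i h1 h2) ^ (lamPlus α i h1 h2))
             else if j.val = i + 1 then bb else 0)) := by
  have hz : ((⟨0, by omega⟩ : Fin m)).val = 0 := rfl
  have ho : ((⟨1, by omega⟩ : Fin m)).val = 1 := rfl
  rw [isEdgeGenerator_sage_iff hmono hz ho]
  have e1 : (fun j : Fin m => if j.val = 0 then (1:ℝ) else 0) = Pi.single ⟨0, by omega⟩ 1 := by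
    ext j
    simp [Pi.single_apply, Fin.ext_iff]
  have e2 : (fun j : Fin m => if j.val = 1 then (1:ℝ) else if j.val = 0 then -1 else 0) =
      Pi.single ⟨1, by omega⟩ 1 - Pi.single ⟨0, by omega⟩ 1 := by
    ext j
    simp only [Pi.sub_apply, Pi.single_apply, Fin.ext_iff]
    split_ifs <;> first | omega | norm_num
  rw [e1, e2]
  have e3 : ∀ (i : ℕ) (h1 : 1 ≤ i) (h2 : i + 1 < m) (x s : ℝ), 0 < s →
      (fun j : Fin m =>
        if j.val = i - 1 then s * circuitVec α x ⟨i - 1, by omega⟩ ⟨i, by omega⟩ ⟨i + 1, h2⟩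
          ⟨i - 1, by omega⟩
        else if j.val = i then
          -((s * circuitVec α x ⟨i - 1, by omega⟩ ⟨i, by omega⟩ ⟨i + 1, h2⟩ ⟨i - 1, by omega⟩ /
              lamMinus α i h1 h2) ^ (lamMinus α i h1 h2) *
            (s * circuitVec α x ⟨i - 1, by omega⟩ ⟨i, by omega⟩ ⟨i + 1, h2⟩ ⟨i + 1, h2⟩ /
              lamPlus α i h1 h2) ^ (lamPlus α i h1 h2))
        else if j.val = i + 1 then
          s * circuitVec α x ⟨i - 1, by omega⟩ ⟨i, by omega⟩ ⟨i + 1, h2⟩ ⟨i + 1, h2⟩ else 0) =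
      s • circuitVec α x ⟨i - 1, by omega⟩ ⟨i, by omega⟩ ⟨i + 1, h2⟩ := by
    intro i h1 h2 x s hs
    have hpq : (⟨i - 1, by omega⟩ : Fin m) < ⟨i, by omega⟩ := Fin.lt_def.2 (by simp; omega)
    have hqk : (⟨i, by omega⟩ : Fin m) < ⟨i + 1, h2⟩ := Fin.lt_def.2 (by simp)
    rw [circuitVec_apply_left hpq hqk, circuitVec_apply_right hpq hqk]
    simp only [lamMinus, lamPlus]
    rw [circuit_number_eq (hmono hpq) (hmono hqk) hs]
    ext j
    simp only [circuitVec, Pi.smul_apply, Pi.add_apply, Pi.sub_apply, Pi.single_apply, Fin.ext_iff,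
      smul_eq_mul]
    split_ifs <;> first | omega | ring
  constructor
  · rintro ⟨s, hs, h | h | ⟨p, q, k, x, hpq, hqk, hx, h⟩⟩
    · exact ⟨s, hs, Or.inl h⟩
    · exact ⟨s, hs, Or.inr (Or.inl h)⟩
    have h1 : 1 ≤ q.val := by omega
    have hq1 : q.val - 1 < m := by omega
    have h2 : q.val + 1 < m := hqk ▸ k.isLt
    obtain rfl : p = ⟨q.val - 1, hq1⟩ := Fin.ext (by simp; omega)
    obtain rfl : k = ⟨q.val + 1, h2⟩ := Fin.ext hqk.symm
    have hpq' : (⟨q.val - 1, by omega⟩ : Fin m) < q := Fin.lt_def.2 (by simp; omega)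
    have hqk' : q < (⟨q.val + 1, h2⟩ : Fin m) := Fin.lt_def.2 (by simp)
    have d1 := sub_pos.2 (hmono hpq')
    have d2 := sub_pos.2 (hmono hqk')
    have d3 := sub_pos.2 (hmono (hpq'.trans hqk'))
    have e := e3 q.val h1 h2 x 1 one_pos
    simp only [one_mul, one_smul] at e
    refine ⟨s, hs, Or.inr (Or.inr ⟨q.val, h1, h2, _, _, ?_, ?_, ?_, h.trans (congrArg _ e.symm)⟩)⟩
    · rw [circuitVec_apply_left hpq' hqk']
      exact mul_pos d2 (Real.exp_pos _)
    · rw [circuitVec_apply_right hpq' hqk']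
      exact mul_pos d1 (Real.exp_pos _)
    · rw [circuitVec_apply_left hpq' hqk', circuitVec_apply_right hpq' hqk']
      simp only [lamMinus, lamPlus]
      rw [div_div_div_cancel_right₀ d3.ne', mul_div_mul_comm]
      refine le_mul_of_one_le_right (div_pos d2 d1).le ?_
      rw [← Real.exp_sub]
      exact Real.one_le_exp (by nlinarith)
  · rintro ⟨t, ht, h | h | ⟨i, h1, h2, a, bb, ha, hbb, hab, h⟩⟩
    · exact ⟨t, ht, Or.inl h⟩
    · exact ⟨t, ht, Or.inr (Or.inl h)⟩
    have hpq : (⟨i - 1, by omega⟩ : Fin m) < ⟨i, by omega⟩ := Fin.lt_def.2 (by simp; omega)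
    have hqk : (⟨i, by omega⟩ : Fin m) < ⟨i + 1, h2⟩ := Fin.lt_def.2 (by simp)
    have d1 := sub_pos.2 (hmono hpq)
    have d2 := sub_pos.2 (hmono hqk)
    have d3 := sub_pos.2 (hmono (hpq.trans hqk))
    have hL : lamMinus α i h1 h2 / lamPlus α i h1 h2 =
        (α ⟨i + 1, h2⟩ - α ⟨i, by omega⟩) / (α ⟨i, by omega⟩ - α ⟨i - 1, by omega⟩) := by
      simp only [lamMinus, lamPlus]
      rw [div_div_div_cancel_right₀ d3.ne']
    rw [hL, div_le_div_iff₀ d1 hbb] at hab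
    generalize hp : (⟨i - 1, by omega⟩ : Fin m) = p at *
    generalize hq : (⟨i, by omega⟩ : Fin m) = q at *
    generalize hk : (⟨i + 1, h2⟩ : Fin m) = k at *
    set x := Real.log (a * (α q - α p) / ((α k - α q) * bb)) / (α k - α p) with hx
    have hx0 : 0 ≤ x := by
      refine div_nonneg (Real.log_nonneg ?_) d3.le
      rwa [one_le_div (mul_pos d2 hbb)]
    set s := a * Real.exp (α p * x) / (α k - α q) with hs
    have hs0 : 0 < s := div_pos (mul_pos ha (Real.exp_pos _)) d2
    have ea : s * circuitVec α x p q k p = a := by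
      rw [circuitVec_apply_left hpq hqk, hs, Real.exp_neg]
      field_simp
    have eb : s * circuitVec α x p q k k = bb := by
      have ex : Real.exp (α k * x) =
          Real.exp (α p * x) * (a * (α q - α p) / ((α k - α q) * bb)) := by
        rw [← Real.exp_log (div_pos (mul_pos ha d1) (mul_pos d2 hbb)), ← Real.exp_add, hx]
        congr 1
        field_simp
        ring
      rw [circuitVec_apply_right hpq hqk, hs, Real.exp_neg, ex]
      field_simp
    have e := e3 i h1 h2 x s hs0
    simp only [hp, hq, hk, ea, eb] at e
    refine ⟨t * s, mul_pos ht hs0, Or.inr (Or.inr ⟨p, q, k, x, ?_, ?_, hx0, ?_⟩)⟩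
    · rw [← hp, ← hq]
      simp
      omega
    · rw [← hq, ← hk]
    · rw [h, e, mul_smul]
end
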